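/- Let Ω ⊂ P(ℝ^d) be a properly convex domain and let S ⊂ Ω be a properly embedded simplex. Then for every x ∈ closure(S), the coarse dimension of the face F_S(x) inside the face F_Ω(x) equals the dimension of F_S(x): cdim_{F_Ω(x)}(F_S(x)) = dim F_S(x). -/

import Mathlib

open Set Filter

noncomputable section

/-- Real projective space `P(ℝ^d)`, with the quotient topology. -/
abbrev PSpace (d : ℕ) := Projectivization ℝ (Fin d → ℝ)

instance PSpace.instTopologicalSpace (d : ℕ) : TopologicalSpace (PSpace d) :=
  inferInstanceAs (TopologicalSpace (Quotient (projectivizationSetoid ℝ (Fin d → ℝ))))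

namespace Paper

variable {d : ℕ}

/-- Inhomogeneous coordinates in the affine chart determined by the linear functional `f`:
a projective point `[v]` with `f v ≠ 0` is sent to the representative `v / f v` lying in the
affine hyperplane `{f = 1}`. -/
def chartMap (f : (Fin d → ℝ) →ₗ[ℝ] ℝ) (x : PSpace d) : Fin d → ℝ :=
  (f x.rep)⁻¹ • x.rep

/-- A subset of `P(ℝ^d)` is properly convex if there is an affine chart in which it is a
bounded convex set. -/
def IsProperlyConvex (C : Set (PSpace d)) : Prop :=
  ∃ f : (Fin d → ℝ) →ₗ[ℝ] ℝ, (∀ x ∈ closure C, f x.rep ≠ 0) ∧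
    Convex ℝ (chartMap f '' C) ∧ Bornology.IsBounded (chartMap f '' C)

/-- A properly convex domain: an open, nonempty, properly convex subset of `P(ℝ^d)`. -/
def IsPCDomain (Ω : Set (PSpace d)) : Prop :=
  IsOpen Ω ∧ Ω.Nonempty ∧ IsProperlyConvex Ω

open Classical in
/-- A choice of an affine chart containing the properly convex set `C`. -/
def chartOf (C : Set (PSpace d)) : (Fin d → ℝ) →ₗ[ℝ] ℝ :=
  if h : IsProperlyConvex C then h.choose else 0

/-- The chart map associated to the chosen chart of `C`. -/
def cmap (C : Set (PSpace d)) : PSpace d → Fin d → ℝ := chartMap (chartOf C)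

/-- The Hilbert distance between `u` and `v` computed in an affine chart where the convex set
is `O`: writing the line through `u, v` as `t ↦ u + t(v-u)`, with boundary parameters
`tm = inf {t | u + t(v-u) ∈ O} ≤ 0` and `tp = sup {...} ≥ 1`, the cross-ratio
`[a,u,v,b]` of `a = u + tm(v-u), u, v, b = u + tp(v-u)` equals `(tp(1-tm))/((-tm)(tp-1))`. -/
def hilbertDistChart (O : Set (Fin d → ℝ)) (u v : Fin d → ℝ) : ℝ :=
  if u = v then 0
  else
    (1 / 2) * Real.log
      ((sSup {t : ℝ | u + t • (v - u) ∈ O} * (1 - sInf {t : ℝ | u + t • (v - u) ∈ O})) /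
        ((-(sInf {t : ℝ | u + t • (v - u) ∈ O})) * (sSup {t : ℝ | u + t • (v - u) ∈ O} - 1)))

/-- The Hilbert metric of a properly convex set `C` (open in its span). -/
def hilbertDist (C : Set (PSpace d)) (x y : PSpace d) : ℝ :=
  hilbertDistChart (cmap C '' C) (cmap C x) (cmap C y)

/-- The closed projective line segment `[x,y]` contained in `closure C`. -/
def projSeg (C : Set (PSpace d)) (x y : PSpace d) : Set (PSpace d) :=
  {z ∈ closure C | cmap C z ∈ segment ℝ (cmap C x) (cmap C y)}

/-- The open projective line segment `(x,y)` contained in `closure C`. -/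
def projOpenSeg (C : Set (PSpace d)) (x y : PSpace d) : Set (PSpace d) :=
  {z ∈ closure C | cmap C z ∈ openSegment ℝ (cmap C x) (cmap C y)}

/-- The open face `F_C(x)` of a point `x ∈ closure C`: the set `{x}` together with all
`y ∈ closure C` such that some open line segment contained in `closure C` contains
both `x` and `y`. -/
def face (C : Set (PSpace d)) (x : PSpace d) : Set (PSpace d) :=
  insert x {y ∈ closure C | ∃ a ∈ closure C, ∃ b ∈ closure C,
    x ∈ projOpenSeg C a b ∧ y ∈ projOpenSeg C a b}

/-- The ideal boundary `∂_i C = closure C \ C`. -/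
def idealBdry (C : Set (PSpace d)) : Set (PSpace d) := closure C \ C

/-- The dimension of a subset `B`, computed in the chart of the ambient convex set `C`. -/
def pdimIn (C B : Set (PSpace d)) : ℕ :=
  Module.finrank ℝ (affineSpan ℝ (cmap C '' B)).direction

/-- The dimension of a convex subset of `P(ℝ^d)`. -/
def pdim (A : Set (PSpace d)) : ℕ := pdimIn A A

/-- The coarse dimension `cdim_C(A)` of a nonempty subset `A` of a properly convex set `C`
open in its span: the smallest `k` such that `A` is contained in an `R`-neighborhood (for the
Hilbert metric of `C`) of a `k`-dimensional convex subset `B ⊆ C`. -/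
def cdim (C A : Set (PSpace d)) : ℕ :=
  sInf {k : ℕ | ∃ R : ℝ, 0 < R ∧ ∃ B : Set (PSpace d), B ⊆ C ∧
    Convex ℝ (cmap C '' B) ∧ pdimIn C B = k ∧
    A ⊆ {p ∈ C | ∃ q ∈ B, hilbertDist C p q < R}}

/-- The cone over the standard open `(p-1)`-dimensional simplex: vectors whose first `p`
coordinates are positive and whose remaining coordinates vanish. -/
def simplexCone (p : ℕ) : Set (Fin d → ℝ) :=
  {v | (∀ i : Fin d, (i : ℕ) < p → 0 < v i) ∧ ∀ i : Fin d, p ≤ (i : ℕ) → v i = 0}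

/-- `S` is the image under `g ∈ PGL_d(ℝ)` of the standard open simplex with `p` vertices. -/
def IsSimplexWithMap (p : ℕ) (S : Set (PSpace d)) (g : (Fin d → ℝ) ≃ₗ[ℝ] (Fin d → ℝ)) : Prop :=
  S = {q : PSpace d | ∃ v ∈ simplexCone (d := d) p, ∃ hv : v ≠ 0,
        q = Projectivization.mk ℝ (g v) (by simpa using hv)}

/-- `S ⊆ P(ℝ^d)` is a simplex of dimension `k`. -/
def IsSimplexOfDim (k : ℕ) (S : Set (PSpace d)) : Prop :=
  k + 1 ≤ d ∧ ∃ g : (Fin d → ℝ) ≃ₗ[ℝ] (Fin d → ℝ), IsSimplexWithMap (k + 1) S g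

/-- `S` is a simplex with vertices `v 0, …, v (p-1)` (so of dimension `p - 1`). -/
def HasVertices {p : ℕ} (S : Set (PSpace d)) (v : Fin p → PSpace d) : Prop :=
  ∃ (hp : p ≤ d) (g : (Fin d → ℝ) ≃ₗ[ℝ] (Fin d → ℝ)),
    IsSimplexWithMap p S g ∧
    ∀ j : Fin p, v j = Projectivization.mk ℝ (g (Pi.single (Fin.castLE hp j) 1))
      (by
        simp only [ne_eq, EmbeddingLike.map_eq_zero_iff]
        intro h
        have h1 := congrFun h (Fin.castLE hp j)
        rw [Pi.single_eq_same] at h1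
        exact one_ne_zero (α := ℝ) h1)

/-- `A ⊆ B` is properly embedded if the inclusion map `A ↪ B` is proper. -/
def IsProperlyEmbedded (A B : Set (PSpace d)) : Prop :=
  ∃ h : A ⊆ B, IsProperMap (Set.inclusion h)

/-- The projective action of `GL(ℝ^d)` (hence of `PGL_d(ℝ)`) on `P(ℝ^d)`. -/
def pact (g : (Fin d → ℝ) ≃ₗ[ℝ] (Fin d → ℝ)) : PSpace d → PSpace d :=
  Projectivization.map g.toLinearMap g.injective

/-- A naive convex co-compact triple `(Ω, C, Λ)`. -/
structure NCCTriple (d : ℕ) where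
  Ω : Set (PSpace d)
  C : Set (PSpace d)
  Λ : Subgroup ((Fin d → ℝ) ≃ₗ[ℝ] (Fin d → ℝ))
  isOpen_Ω : IsOpen Ω
  nonempty_Ω : Ω.Nonempty
  properlyConvex_Ω : IsProperlyConvex Ω
  inv_Ω : ∀ g ∈ Λ, pact g '' Ω = Ω
  infinite_Λ : (Λ : Set ((Fin d → ℝ) ≃ₗ[ℝ] (Fin d → ℝ))).Infinite
  discrete_Λ : ∀ K ⊆ Ω, IsCompact K →
    {g : (Fin d → ℝ) ≃ₗ[ℝ] (Fin d → ℝ) | g ∈ Λ ∧ (pact g '' K ∩ K).Nonempty}.Finite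
  C_nonempty : C.Nonempty
  C_sub : C ⊆ Ω
  C_closedInΩ : closure C ∩ Ω ⊆ C
  C_convex : Convex ℝ (cmap Ω '' C)
  inv_C : ∀ g ∈ Λ, pact g '' C = C
  cocompact : ∃ K : Set (PSpace d), K ⊆ C ∧ IsCompact K ∧ C ⊆ ⋃ g ∈ Λ, pact g '' K

/-- The orbit of a point under a subgroup of `PGL_d(ℝ)`. -/
def porbit (Λ : Subgroup ((Fin d → ℝ) ≃ₗ[ℝ] (Fin d → ℝ))) (p : PSpace d) : Set (PSpace d) :=
  {q | ∃ g ∈ Λ, q = pact g p}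

/-- The full orbital limit set `L_Ω(Λ)`. -/
def limitSet (Ω : Set (PSpace d)) (Λ : Subgroup ((Fin d → ℝ) ≃ₗ[ℝ] (Fin d → ℝ))) :
    Set (PSpace d) :=
  ⋃ p ∈ Ω, (closure (porbit Λ p) \ porbit Λ p)

/-- The convex hull of `X ⊆ closure Ω` taken inside `Ω`. -/
def convHullIn (Ω X : Set (PSpace d)) : Set (PSpace d) :=
  {z ∈ Ω | cmap Ω z ∈ convexHull ℝ (cmap Ω '' X)}

/-- `C_Ω(Λ)`: the convex hull of the full orbital limit set in `Ω`. -/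
def coreC (Ω : Set (PSpace d)) (Λ : Subgroup ((Fin d → ℝ) ≃ₗ[ℝ] (Fin d → ℝ))) :
    Set (PSpace d) :=
  convHullIn Ω (limitSet Ω Λ)

/-- A convex co-compact group `Λ ⊆ Aut(Ω)`: an infinite discrete subgroup preserving `Ω`
such that `C_Ω(Λ)` is nonempty and `Λ` acts cocompactly on it. -/
structure CCSetup (d : ℕ) where
  Ω : Set (PSpace d)
  Λ : Subgroup ((Fin d → ℝ) ≃ₗ[ℝ] (Fin d → ℝ))
  isOpen_Ω : IsOpen Ω
  nonempty_Ω : Ω.Nonempty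
  properlyConvex_Ω : IsProperlyConvex Ω
  inv_Ω : ∀ g ∈ Λ, pact g '' Ω = Ω
  infinite_Λ : (Λ : Set ((Fin d → ℝ) ≃ₗ[ℝ] (Fin d → ℝ))).Infinite
  discrete_Λ : ∀ K ⊆ Ω, IsCompact K →
    {g : (Fin d → ℝ) ≃ₗ[ℝ] (Fin d → ℝ) | g ∈ Λ ∧ (pact g '' K ∩ K).Nonempty}.Finite
  core_nonempty : (coreC Ω Λ).Nonempty
  cocompact : ∃ K : Set (PSpace d), K ⊆ coreC Ω Λ ∧ IsCompact K ∧
    coreC Ω Λ ⊆ ⋃ g ∈ Λ, pact g '' K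

/-- The Gromov product of `x, y` at `w`, with respect to the Hilbert metric of `Ω`. -/
def gromovProd (Ω : Set (PSpace d)) (w x y : PSpace d) : ℝ :=
  (hilbertDist Ω x w + hilbertDist Ω y w - hilbertDist Ω x y) / 2

/-- `(C, d_Ω)` is Gromov hyperbolic. -/
def GromovHyperbolicOn (Ω C : Set (PSpace d)) : Prop :=
  ∃ δ : ℝ, 0 ≤ δ ∧ ∀ x ∈ C, ∀ y ∈ C, ∀ z ∈ C, ∀ w ∈ C,
    min (gromovProd Ω w x y) (gromovProd Ω w y z) - δ ≤ gromovProd Ω w x z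

/-- The open Hilbert-metric ball in `Ω`. -/
def hBall (Ω : Set (PSpace d)) (x : PSpace d) (r : ℝ) : Set (PSpace d) :=
  {y ∈ Ω | hilbertDist Ω x y < r}

/-- The Hausdorff distance between `A` and `B` (w.r.t. the Hilbert metric of `Ω`)
is less than `ε`. -/
def hausLT (Ω A B : Set (PSpace d)) (ε : ℝ) : Prop :=
  (∀ a ∈ A, ∃ b ∈ B, hilbertDist Ω a b < ε) ∧ ∀ b ∈ B, ∃ a ∈ A, hilbertDist Ω a b < ε

/-- The Hausdorff distance between `A` and `B` (w.r.t. the Hilbert metric of `Ω`)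
is at most `r`. -/
def hausdorffDistLE (Ω A B : Set (PSpace d)) (r : ℝ) : Prop :=
  ∀ ε : ℝ, 0 < ε → hausLT Ω A B (r + ε)

/-- Convergence `F n → C` in the local Hausdorff topology induced by `d_Ω`. -/
def LocalHausConv (Ω : Set (PSpace d)) (F : ℕ → Set (PSpace d)) (C : Set (PSpace d)) : Prop :=
  ∀ x ∈ Ω, ∀ r : ℝ, 0 < r → ∀ ε : ℝ, 0 < ε →
    ∀ᶠ n in atTop, hausLT Ω (F n ∩ hBall Ω x r) (C ∩ hBall Ω x r) ε

/-- A collection `𝒮` of closed subsets of `Ω` is closed and discrete in the local Hausdorff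
topology: any sequence in `𝒮` converging to a nonempty closed subset of `Ω` has limit in `𝒮`
and is eventually equal to its limit. -/
def ClosedAndDiscreteInLHT (Ω : Set (PSpace d)) (𝒮 : Set (Set (PSpace d))) : Prop :=
  ∀ F : ℕ → Set (PSpace d), (∀ n, F n ∈ 𝒮) →
    ∀ C : Set (PSpace d), C.Nonempty → C ⊆ Ω → closure C ∩ Ω ⊆ C → LocalHausConv Ω F C →
      C ∈ 𝒮 ∧ ∀ᶠ n in atTop, F n = C


/-! ### Projective points and charts -/

/-- the set of projective points represented by nonzero vectors of `Q` -/
def pr (Q : Set (Fin d → ℝ)) : Set (PSpace d) :=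
  {q | ∃ v ∈ Q, ∃ h : v ≠ 0, Projectivization.mk ℝ v h = q}

lemma mem_pr {Q : Set (Fin d → ℝ)} {v : Fin d → ℝ} (hv : v ∈ Q) (h : v ≠ 0) :
    Projectivization.mk ℝ v h ∈ pr Q := ⟨v, hv, h, rfl⟩

lemma pr_mono {Q Q' : Set (Fin d → ℝ)} (h : Q ⊆ Q') : pr Q ⊆ pr Q' := by
  rintro _ ⟨v, hv, h0, rfl⟩
  exact mem_pr (h hv) h0

lemma isQuotientMap_mk : Topology.IsQuotientMap
    (fun v : {v : Fin d → ℝ // v ≠ 0} => (Projectivization.mk ℝ v.1 v.2 : PSpace d)) :=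
  isQuotientMap_quot_mk

lemma rep_ne_iff (f : (Fin d → ℝ) →ₗ[ℝ] ℝ) (v : Fin d → ℝ) (h : v ≠ 0) :
    f (Projectivization.mk ℝ v h).rep ≠ 0 ↔ f v ≠ 0 := by
  obtain ⟨a, ha⟩ := Projectivization.exists_smul_eq_mk_rep ℝ v h
  rw [← ha, Units.smul_def, map_smul]
  simp

lemma chartMap_mk (f : (Fin d → ℝ) →ₗ[ℝ] ℝ) (v : Fin d → ℝ) (h : v ≠ 0) :
    chartMap f (Projectivization.mk ℝ v h) = (f v)⁻¹ • v := by
  obtain ⟨a, ha⟩ := Projectivization.exists_smul_eq_mk_rep ℝ v h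
  unfold chartMap
  rw [← ha, Units.smul_def, map_smul, smul_smul]
  have : (a : ℝ) ≠ 0 := a.ne_zero
  congr 1
  simp only [smul_eq_mul, mul_inv]
  field_simp

lemma mk_smul (v : Fin d → ℝ) (h : v ≠ 0) (c : ℝ) (h' : c • v ≠ 0) :
    (Projectivization.mk ℝ (c • v) h' : PSpace d) = Projectivization.mk ℝ v h := by
  rw [Projectivization.mk_eq_mk_iff']
  exact ⟨c, rfl⟩

lemma chartMap_apply (f : (Fin d → ℝ) →ₗ[ℝ] ℝ) (x : PSpace d) (hx : f x.rep ≠ 0) :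
    f (chartMap f x) = 1 := by
  unfold chartMap
  rw [map_smul, smul_eq_mul, inv_mul_cancel₀ hx]

lemma mk_chartMap (f : (Fin d → ℝ) →ₗ[ℝ] ℝ) (x : PSpace d)
    (h : chartMap f x ≠ 0) : Projectivization.mk ℝ (chartMap f x) h = x := by
  conv_rhs => rw [← Projectivization.mk_rep x]
  exact mk_smul _ _ _ _

lemma chartMap_neg (f : (Fin d → ℝ) →ₗ[ℝ] ℝ) (x : PSpace d) :
    chartMap (-f) x = - chartMap f x := by
  unfold chartMap
  simp [inv_neg]

lemma isOpen_chart (f : (Fin d → ℝ) →ₗ[ℝ] ℝ) : IsOpen {x : PSpace d | f x.rep ≠ 0} := by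
  rw [← isQuotientMap_mk.isOpen_preimage]
  have : ((fun v : {v : Fin d → ℝ // v ≠ 0} => (Projectivization.mk ℝ v.1 v.2 : PSpace d)) ⁻¹'
      {x : PSpace d | f x.rep ≠ 0}) = {v | f v.1 ≠ 0} := by
    ext v
    exact rep_ne_iff f v.1 v.2
  rw [this]
  exact isOpen_ne_fun (f.continuous_of_finiteDimensional.comp continuous_subtype_val)
    continuous_const

lemma continuousOn_chartMap (f : (Fin d → ℝ) →ₗ[ℝ] ℝ) :
    ContinuousOn (chartMap f) {x : PSpace d | f x.rep ≠ 0} := by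
  rw [isQuotientMap_mk.continuousOn_isOpen_iff (isOpen_chart f)]
  have hf : Continuous (fun v : {v : Fin d → ℝ // v ≠ 0} => f v.1) :=
    f.continuous_of_finiteDimensional.comp continuous_subtype_val
  have : ContinuousOn (fun v : {v : Fin d → ℝ // v ≠ 0} => (f v.1)⁻¹ • v.1)
      {v | f v.1 ≠ 0} :=
    (hf.continuousOn.inv₀ (fun v hv => hv)).smul continuous_subtype_val.continuousOn
  refine (this.mono ?_).congr ?_
  · intro v hv
    exact (rep_ne_iff f v.1 v.2).1 hv
  · intro v _
    exact chartMap_mk f v.1 v.2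

lemma tendsto_mk {α : Type*} {l : Filter α} {u : α → Fin d → ℝ} {v : Fin d → ℝ}
    (hu : ∀ a, u a ≠ 0) (hv : v ≠ 0) (h : Tendsto u l (nhds v)) :
    Tendsto (fun a => (Projectivization.mk ℝ (u a) (hu a) : PSpace d)) l
      (nhds (Projectivization.mk ℝ v hv)) := by
  have h1 : Tendsto (fun a => (⟨u a, hu a⟩ : {v : Fin d → ℝ // v ≠ 0})) l (nhds ⟨v, hv⟩) :=
    tendsto_subtype_rng.2 h
  exact (isQuotientMap_mk.continuous.tendsto _).comp h1

lemma chart_closure_subset {C : Set (PSpace d)} {f : (Fin d → ℝ) →ₗ[ℝ] ℝ}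
    (hf : ∀ x ∈ closure C, f x.rep ≠ 0) :
    chartMap f '' closure C ⊆ closure (chartMap f '' C) := by
  rintro _ ⟨x, hx, rfl⟩
  have hc : ContinuousWithinAt (chartMap f) C x :=
    ((continuousOn_chartMap f).continuousAt ((isOpen_chart f).mem_nhds (hf x hx))).continuousWithinAt
  exact hc.mem_closure_image hx

lemma closure_chart_subset {C : Set (PSpace d)} {f : (Fin d → ℝ) →ₗ[ℝ] ℝ}
    (hf : ∀ x ∈ closure C, f x.rep ≠ 0) {w : Fin d → ℝ} (hw : w ∈ closure (chartMap f '' C)) :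
    f w = 1 ∧ ∀ h : w ≠ 0, Projectivization.mk ℝ w h ∈ closure C := by
  have h1 : closure (chartMap f '' C) ⊆ {w | f w = 1} := by
    apply closure_minimal
    · rintro _ ⟨x, hx, rfl⟩
      exact chartMap_apply f x (hf x (subset_closure hx))
    · exact isClosed_eq f.continuous_of_finiteDimensional continuous_const
  refine ⟨h1 hw, fun h => ?_⟩
  obtain ⟨u, hu, hlim⟩ := mem_closure_iff_seq_limit.1 hw
  have h0 : ∀ n, u n ≠ 0 := by
    intro n hn
    have := h1 (subset_closure (hu n))
    simp [hn] at this
  refine mem_closure_of_tendsto (tendsto_mk h0 h hlim) (Eventually.of_forall fun n => ?_)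
  obtain ⟨x, hx, hxn⟩ := hu n
  have := mk_chartMap f x (by rw [hxn]; exact h0 n)
  simp only [hxn] at this
  rw [this]; exact hx

/-! ### Cones -/

/-- convex cones without the origin -/
structure OC (Q : Set (Fin d → ℝ)) : Prop where
  zero : (0 : Fin d → ℝ) ∉ Q
  add : ∀ u ∈ Q, ∀ v ∈ Q, u + v ∈ Q
  smul : ∀ c : ℝ, 0 < c → ∀ u ∈ Q, c • u ∈ Q

/-- pointed convex cones -/
structure PC (P : Set (Fin d → ℝ)) : Prop where
  zero : (0 : Fin d → ℝ) ∈ P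
  add : ∀ u ∈ P, ∀ v ∈ P, u + v ∈ P
  smul : ∀ c : ℝ, 0 ≤ c → ∀ u ∈ P, c • u ∈ P
  pointed : ∀ u ∈ P, -u ∈ P → u = 0

/-- the relation of lying in the same open face of a cone -/
def Eqv (P : Set (Fin d → ℝ)) (u v : Fin d → ℝ) : Prop :=
  ∃ M : ℝ, 0 < M ∧ M • u - v ∈ P ∧ M • v - u ∈ P

lemma PC.oc {P : Set (Fin d → ℝ)} (hP : PC P) : OC {u | u ∈ P ∧ u ≠ 0} := by
  refine ⟨fun h => h.2 rfl, ?_, ?_⟩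
  · rintro u ⟨hu, hu0⟩ v ⟨hv, hv0⟩
    refine ⟨hP.add u hu v hv, fun h => hu0 (hP.pointed u hu ?_)⟩
    rwa [neg_eq_of_add_eq_zero_right h]
  · rintro c hc u ⟨hu, hu0⟩
    exact ⟨hP.smul c hc.le u hu, smul_ne_zero hc.ne' hu0⟩

lemma Eqv.symm {P : Set (Fin d → ℝ)} {u v : Fin d → ℝ} (h : Eqv P u v) : Eqv P v u := by
  obtain ⟨M, hM, h1, h2⟩ := h
  exact ⟨M, hM, h2, h1⟩

lemma PC.large {P : Set (Fin d → ℝ)} (hP : PC P) {u v : Fin d → ℝ} (hu : u ∈ P) {M N : ℝ}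
    (h : M • u - v ∈ P) (hMN : M ≤ N) : N • u - v ∈ P := by
  have := hP.add _ h _ (hP.smul (N - M) (by linarith) u hu)
  convert this using 1
  module

lemma PC.eqv_of {P : Set (Fin d → ℝ)} (hP : PC P) {u v : Fin d → ℝ} (hu : u ∈ P) (hv : v ∈ P)
    {M N : ℝ} (h : M • u - v ∈ P) (h' : N • v - u ∈ P) : Eqv P u v :=
  ⟨max 1 (max M N), by positivity, hP.large hu h (by simp), hP.large hv h' (by simp)⟩

lemma PC.eqv_refl {P : Set (Fin d → ℝ)} (hP : PC P) (u : Fin d → ℝ) : Eqv P u u :=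
  ⟨1, one_pos, by simpa using hP.zero, by simpa using hP.zero⟩

lemma Eqv.exists_large {P : Set (Fin d → ℝ)} (hP : PC P) {u v : Fin d → ℝ} (hu : u ∈ P)
    (hv : v ∈ P) (h : Eqv P u v) : ∃ M : ℝ, 1 < M ∧ M • u - v ∈ P ∧ M • v - u ∈ P := by
  obtain ⟨M, hM, h1, h2⟩ := h
  exact ⟨M + 1, by linarith, hP.large hu h1 (by linarith), hP.large hv h2 (by linarith)⟩

lemma Eqv.trans {P : Set (Fin d → ℝ)} (hP : PC P) {u v w : Fin d → ℝ}
    (h : Eqv P u v) (h' : Eqv P v w) : Eqv P u w := by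
  obtain ⟨M, hM, h1, h2⟩ := h
  obtain ⟨N, hN, h3, h4⟩ := h'
  refine ⟨N * M, by positivity, ?_, ?_⟩
  · convert hP.add _ (hP.smul N hN.le _ h1) _ h3 using 1
    module
  · convert hP.add _ (hP.smul M hM.le _ h4) _ h2 using 1
    module

lemma Eqv.add {P : Set (Fin d → ℝ)} (hP : PC P) {u v u' v' : Fin d → ℝ}
    (hu : u ∈ P) (hv : v ∈ P) (hu' : u' ∈ P) (hv' : v' ∈ P)
    (h : Eqv P u v) (h' : Eqv P u' v') : Eqv P (u + u') (v + v') := by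
  obtain ⟨M, hM, h1, h2⟩ := h
  obtain ⟨N, hN, h3, h4⟩ := h'
  refine ⟨max M N, by positivity, ?_, ?_⟩
  · convert hP.add _ (hP.large hu h1 (le_max_left M N)) _
      (hP.large hu' h3 (le_max_right M N)) using 1
    module
  · convert hP.add _ (hP.large hv h2 (le_max_left M N)) _
      (hP.large hv' h4 (le_max_right M N)) using 1
    module

lemma Eqv.smul {P : Set (Fin d → ℝ)} (hP : PC P) {u v : Fin d → ℝ} (h : Eqv P u v)
    {c : ℝ} (hc : 0 ≤ c) : Eqv P (c • u) (c • v) := by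
  obtain ⟨M, hM, h1, h2⟩ := h
  refine ⟨M, hM, ?_, ?_⟩
  · convert hP.smul c hc _ h1 using 1
    module
  · convert hP.smul c hc _ h2 using 1
    module

lemma PC.eqv_smul {P : Set (Fin d → ℝ)} (hP : PC P) {u : Fin d → ℝ} (hu : u ∈ P)
    {c : ℝ} (hc : 0 < c) : Eqv P (c • u) u := by
  refine hP.eqv_of (M := c⁻¹) (N := c) (hP.smul c hc.le u hu) hu ?_ ?_
  · rw [smul_smul, inv_mul_cancel₀ hc.ne', one_smul, sub_self]; exact hP.zero
  · rw [sub_self]; exact hP.zero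

lemma PC.eqv_sum {P : Set (Fin d → ℝ)} (hP : PC P) {ι : Type*} (s : Finset ι)
    {u v : ι → Fin d → ℝ} (hu : ∀ i, u i ∈ P) (hv : ∀ i, v i ∈ P) (h : ∀ i, Eqv P (u i) (v i)) :
    (∑ i ∈ s, u i) ∈ P ∧ (∑ i ∈ s, v i) ∈ P ∧ Eqv P (∑ i ∈ s, u i) (∑ i ∈ s, v i) := by
  classical
  induction s using Finset.induction_on with
  | empty => simpa using ⟨hP.zero, hP.eqv_refl 0⟩
  | insert a s ha ih =>
    rw [Finset.sum_insert ha, Finset.sum_insert ha]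
    exact ⟨hP.add _ (hu a) _ ih.1, hP.add _ (hv a) _ ih.2.1,
      Eqv.add hP (hu a) (hv a) ih.1 ih.2.1 (h a) ih.2.2⟩

lemma Eqv.ne_zero {P : Set (Fin d → ℝ)} (hP : PC P) {u v : Fin d → ℝ} (hv : v ∈ P)
    (hv0 : v ≠ 0) (h : Eqv P u v) : u ≠ 0 := by
  obtain ⟨M, hM, h1, h2⟩ := h
  rintro rfl
  exact hv0 (hP.pointed v hv (by simpa using h1))

/-- the open face of `v` in the cone `P` -/
def FC (P : Set (Fin d → ℝ)) (v : Fin d → ℝ) : Set (Fin d → ℝ) := {u | u ∈ P ∧ Eqv P u v}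

lemma PC.oc_FC {P : Set (Fin d → ℝ)} (hP : PC P) {v : Fin d → ℝ} (hv : v ∈ P) (hv0 : v ≠ 0) :
    OC (FC P v) := by
  refine ⟨fun h => h.2.ne_zero hP hv hv0 rfl, ?_, ?_⟩
  · rintro u ⟨hu, hu'⟩ w ⟨hw, hw'⟩
    refine ⟨hP.add u hu w hw, ?_⟩
    have := Eqv.add hP hu hv hw hv hu' hw'
    refine this.trans hP ?_
    have h2 := hP.eqv_smul hv (c := 2) (by norm_num)
    rwa [two_smul] at h2
  · rintro c hc u ⟨hu, hu'⟩
    exact ⟨hP.smul c hc.le u hu, (hP.eqv_smul hu hc).trans hP hu'⟩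

lemma OC.sgn {Q : Set (Fin d → ℝ)} (hQ : OC Q) {f : (Fin d → ℝ) →ₗ[ℝ] ℝ}
    (hf : ∀ u ∈ Q, f u ≠ 0) : ∀ u ∈ Q, ∀ v ∈ Q, 0 < f u * f v := by
  have key : ∀ u ∈ Q, ∀ v ∈ Q, 0 < f u → 0 < f v := by
    intro u hu v hv h
    by_contra hn
    have hv' : f v < 0 := lt_of_le_of_ne (not_lt.1 hn) (hf v hv)
    have := hf _ (hQ.add _ (hQ.smul (-f v) (by linarith) u hu) _ (hQ.smul (f u) h v hv))
    apply this
    simp only [map_add, map_smul, smul_eq_mul]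
    ring
  intro u hu v hv
  rcases lt_or_gt_of_ne (hf u hu) with h | h
  · have : f v < 0 := by
      by_contra hn
      have hv' : 0 < f v := lt_of_le_of_ne (not_lt.1 hn) (hf v hv).symm
      linarith [key v hv u hu hv']
    exact mul_pos_of_neg_of_neg h this
  · exact mul_pos h (key u hu v hv h)

lemma div_pos_of_sgn {a b : ℝ} (h : 0 < a * b) : 0 < a / b := by
  rcases pos_and_pos_or_neg_and_neg_of_mul_pos h with ⟨h1, h2⟩ | ⟨h1, h2⟩
  · exact div_pos h1 h2
  · exact div_pos_of_neg_of_neg h1 h2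

lemma OC.mem_of {P Q : Set (Fin d → ℝ)} (hP : OC P) (hQ : OC Q) {f : (Fin d → ℝ) →ₗ[ℝ] ℝ}
    (hf : ∀ u ∈ Q, f u ≠ 0) (hsub : pr P ⊆ pr Q) {x : Fin d → ℝ} (hx : x ∈ P) (hx' : x ∈ Q) :
    P ⊆ Q := by
  have hlift : ∀ u ∈ P, ∃ v ∈ Q, ∃ a : ℝ, a • v = u := by
    intro u hu
    have hu0 : u ≠ 0 := fun h => hP.zero (h ▸ hu)
    obtain ⟨v, hv, hv0, h⟩ := hsub (mem_pr hu hu0)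
    obtain ⟨a, ha⟩ := (Projectivization.mk_eq_mk_iff' ℝ _ _ _ _).1 h.symm
    exact ⟨v, hv, a, ha⟩
  have hfP : ∀ u ∈ P, f u ≠ 0 := by
    intro u hu
    obtain ⟨v, hv, a, rfl⟩ := hlift u hu
    rw [map_smul, smul_eq_mul]
    refine mul_ne_zero ?_ (hf v hv)
    rintro rfl
    rw [zero_smul] at hu
    exact hP.zero hu
  intro u hu
  obtain ⟨v, hv, a, rfl⟩ := hlift u hu
  have h1 := hP.sgn hfP _ hu x hx
  have h2 := hQ.sgn hf v hv x hx'
  rw [map_smul, smul_eq_mul] at h1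
  refine hQ.smul a ?_ v hv
  have h3 : 0 < a * (f v * f x) := by linarith
  exact pos_of_mul_pos_left h3 h2.le

lemma chart_seg (f : (Fin d → ℝ) →ₗ[ℝ] ℝ) {u a b : Fin d → ℝ} (hu0 : u ≠ 0) (ha0 : a ≠ 0)
    (hb0 : b ≠ 0) (hua : 0 < f u * f a) (hub : 0 < f u * f b) :
    chartMap f (Projectivization.mk ℝ u hu0) ∈ openSegment ℝ
      (chartMap f (Projectivization.mk ℝ a ha0)) (chartMap f (Projectivization.mk ℝ b hb0)) ↔
    ∃ r s : ℝ, 0 < r ∧ 0 < s ∧ u = r • a + s • b := by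
  have hu : f u ≠ 0 := left_ne_zero_of_mul hua.ne'
  have ha : f a ≠ 0 := right_ne_zero_of_mul hua.ne'
  have hb : f b ≠ 0 := right_ne_zero_of_mul hub.ne'
  rw [chartMap_mk, chartMap_mk, chartMap_mk]
  have hua' := div_pos_of_sgn hua
  have hub' := div_pos_of_sgn hub
  constructor
  · rintro ⟨r, s, hr, hs, hrs, h⟩
    refine ⟨r * (f u / f a), s * (f u / f b), by positivity, by positivity, ?_⟩
    have h2 : u = f u • ((f u)⁻¹ • u) := by rw [smul_smul, mul_inv_cancel₀ hu, one_smul]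
    rw [h2, ← h, smul_add, smul_smul, smul_smul, smul_smul, smul_smul]
    congr 2
    · simp; field_simp; linarith
    · simp; field_simp; linarith
  · rintro ⟨r, s, hr, hs, h⟩
    refine ⟨r * (f u / f a)⁻¹, s * (f u / f b)⁻¹, by positivity, by positivity, ?_, ?_⟩
    · have : f u = r * f a + s * f b := by rw [h]; simp
      field_simp
      linarith
    · rw [smul_smul, smul_smul]
      conv_rhs => rw [h, smul_add, smul_smul, smul_smul, ← h]
      congr 2
      · field_simp
      · field_simp

lemma OC.convex_chart {Q : Set (Fin d → ℝ)} (hQ : OC Q) {f : (Fin d → ℝ) →ₗ[ℝ] ℝ}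
    (hf : ∀ u ∈ Q, f u ≠ 0) : Convex ℝ (chartMap f '' pr Q) := by
  rw [convex_iff_openSegment_subset]
  rintro _ ⟨_, ⟨a, ha, ha0, rfl⟩, rfl⟩ _ ⟨_, ⟨b, hb, hb0, rfl⟩, rfl⟩ y hy
  obtain ⟨r, s, hr, hs, hrs, rfl⟩ := hy
  have hab := hQ.sgn hf a ha b hb
  have hfa := hf a ha
  have hfb := hf b hb
  -- choose a common positive factor
  have hq : (r : ℝ) • a + (s * (f a / f b)) • b ∈ Q :=
    hQ.add _ (hQ.smul r hr a ha) _
      (hQ.smul _ (mul_pos hs (div_pos_of_sgn hab)) b hb)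
  have hq0 : (r : ℝ) • a + (s * (f a / f b)) • b ≠ 0 := fun h => hQ.zero (h ▸ hq)
  refine ⟨_, mem_pr hq hq0, ?_⟩
  rw [chartMap_mk, chartMap_mk, chartMap_mk]
  have : f ((r : ℝ) • a + (s * (f a / f b)) • b) = f a := by
    simp only [map_add, map_smul, smul_eq_mul]
    field_simp
    linear_combination hrs
  rw [this, smul_add, smul_smul, smul_smul, smul_smul, smul_smul]
  congr 2
  · ring
  · field_simp

lemma mem_chart_iff {Q : Set (Fin d → ℝ)} (hQ : OC Q) {f : (Fin d → ℝ) →ₗ[ℝ] ℝ}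
    (hf : ∀ u ∈ Q, 0 < f u) (y : Fin d → ℝ) : y ∈ chartMap f '' pr Q ↔ f y = 1 ∧ y ∈ Q := by
  constructor
  · rintro ⟨_, ⟨v, hv, hv0, rfl⟩, rfl⟩
    rw [chartMap_mk]
    have := hf v hv
    refine ⟨?_, hQ.smul _ (by positivity) v hv⟩
    rw [map_smul, smul_eq_mul, inv_mul_cancel₀ this.ne']
  · rintro ⟨h1, h2⟩
    have h0 : y ≠ 0 := fun h => hQ.zero (h ▸ h2)
    refine ⟨_, mem_pr h2 h0, ?_⟩
    rw [chartMap_mk, h1]; simp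

lemma finrank_chart {D : Set (Fin d → ℝ)} (hD : D.Nonempty) (f : (Fin d → ℝ) →ₗ[ℝ] ℝ)
    (hf : ∀ v ∈ D, f v = 1) :
    Module.finrank ℝ (affineSpan ℝ D).direction + 1 = Module.finrank ℝ (Submodule.span ℝ D) := by
  obtain ⟨b, hb⟩ := hD
  rw [direction_affineSpan]
  have hb0 : b ≠ 0 := by
    rintro rfl
    simpa using hf 0 hb
  have hker : vectorSpan ℝ D ≤ LinearMap.ker f := by
    rw [vectorSpan_def, Submodule.span_le]
    rintro _ ⟨x, hx, y, hy, rfl⟩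
    simp [hf x hx, hf y hy]
  have hsup : Submodule.span ℝ D = vectorSpan ℝ D ⊔ Submodule.span ℝ {b} := by
    apply le_antisymm
    · rw [Submodule.span_le]
      intro x hx
      rw [SetLike.mem_coe, Submodule.mem_sup]
      refine ⟨x - b, vsub_mem_vectorSpan ℝ hx hb, b, Submodule.mem_span_singleton_self b, ?_⟩
      abel
    · refine sup_le ?_ (Submodule.span_mono (by simpa using hb))
      rw [vectorSpan_def, Submodule.span_le]
      rintro _ ⟨x, hx, y, hy, rfl⟩
      exact Submodule.sub_mem _ (Submodule.subset_span hx) (Submodule.subset_span hy)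
  have hinf : vectorSpan ℝ D ⊓ Submodule.span ℝ {b} = ⊥ := by
    rw [eq_bot_iff]
    rintro x ⟨hx, hx'⟩
    obtain ⟨c, rfl⟩ := Submodule.mem_span_singleton.1 hx'
    have := hker hx
    rw [LinearMap.mem_ker, map_smul, hf b hb] at this
    have hc : c = 0 := by simpa using this
    simp [hc]
  have := Submodule.finrank_sup_add_finrank_inf_eq (vectorSpan ℝ D) (Submodule.span ℝ {b})
  rw [hinf, ← hsup, finrank_span_singleton hb0, finrank_bot] at this
  omega

lemma span_chart {Q : Set (Fin d → ℝ)} (hQ : OC Q) {f : (Fin d → ℝ) →ₗ[ℝ] ℝ}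
    (hf : ∀ u ∈ Q, f u ≠ 0) :
    Submodule.span ℝ (chartMap f '' pr Q) = Submodule.span ℝ Q := by
  apply le_antisymm
  · rw [Submodule.span_le]
    rintro _ ⟨_, ⟨v, hv, hv0, rfl⟩, rfl⟩
    rw [chartMap_mk]
    exact Submodule.smul_mem _ _ (Submodule.subset_span hv)
  · rw [Submodule.span_le]
    intro v hv
    have hv0 : v ≠ 0 := fun h => hQ.zero (h ▸ hv)
    have h1 : chartMap f (Projectivization.mk ℝ v hv0) ∈
      Submodule.span ℝ (chartMap f '' pr Q) := Submodule.subset_span ⟨_, mem_pr hv hv0, rfl⟩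
    rw [chartMap_mk] at h1
    have := Submodule.smul_mem _ (f v) h1
    rwa [smul_smul, mul_inv_cancel₀ (hf v hv), one_smul] at this

lemma finrank_chart_pr {Q : Set (Fin d → ℝ)} (hQ : OC Q) (hne : Q.Nonempty)
    {f : (Fin d → ℝ) →ₗ[ℝ] ℝ} (hf : ∀ u ∈ Q, f u ≠ 0) :
    Module.finrank ℝ (affineSpan ℝ (chartMap f '' pr Q)).direction + 1
      = Module.finrank ℝ (Submodule.span ℝ Q) := by
  rw [← span_chart hQ hf]
  apply finrank_chart _ f
  · rintro _ ⟨_, ⟨v, hv, hv0, rfl⟩, rfl⟩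
    rw [chartMap_mk, map_smul, smul_eq_mul, inv_mul_cancel₀ (hf v hv)]
  · obtain ⟨v, hv⟩ := hne
    have hv0 : v ≠ 0 := fun h => hQ.zero (h ▸ hv)
    exact ⟨_, _, mem_pr hv hv0, rfl⟩

lemma chartOf_spec {C : Set (PSpace d)} (h : IsProperlyConvex C) :
    (∀ x ∈ closure C, chartOf C x.rep ≠ 0) ∧
    Convex ℝ (chartMap (chartOf C) '' C) ∧ Bornology.IsBounded (chartMap (chartOf C) '' C) := by
  unfold chartOf
  rw [dif_pos h]
  exact h.choose_spec

/-- description of faces by cones -/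
lemma face_eq {C : Set (PSpace d)} (hC : IsProperlyConvex C) {P : Set (Fin d → ℝ)} (hP : PC P)
    (hcl : closure C = pr P) {v : Fin d → ℝ} (hv : v ∈ P) (hv0 : v ≠ 0) :
    face C (Projectivization.mk ℝ v hv0) = pr (FC P v) := by
  have hf : ∀ u ∈ {u | u ∈ P ∧ u ≠ 0}, chartOf C u ≠ 0 := by
    rintro u ⟨hu, hu0⟩
    have h1 : Projectivization.mk ℝ u hu0 ∈ closure C := by rw [hcl]; exact mem_pr hu hu0
    exact (rep_ne_iff _ u hu0).1 ((chartOf_spec hC).1 _ h1)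
  have hsgn := hP.oc.sgn hf
  ext y
  constructor
  · rintro (rfl | ⟨hy, a, ha, b, hb, ⟨_, hxs⟩, ⟨_, hys⟩⟩)
    · exact ⟨v, ⟨hv, hP.eqv_refl v⟩, hv0, rfl⟩
    · rw [hcl] at hy ha hb
      obtain ⟨u, hu, hu0, rfl⟩ := hy
      obtain ⟨a, ha, ha0, rfl⟩ := ha
      obtain ⟨b, hb, hb0, rfl⟩ := hb
      unfold cmap at hxs hys
      rw [chart_seg _ _ _ _ (hsgn _ ⟨hv, hv0⟩ _ ⟨ha, ha0⟩) (hsgn _ ⟨hv, hv0⟩ _ ⟨hb, hb0⟩)] at hxs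
      rw [chart_seg _ _ _ _ (hsgn _ ⟨hu, hu0⟩ _ ⟨ha, ha0⟩) (hsgn _ ⟨hu, hu0⟩ _ ⟨hb, hb0⟩)] at hys
      obtain ⟨r, s, hr, hs, rfl⟩ := hxs
      obtain ⟨r', s', hr', hs', rfl⟩ := hys
      refine ⟨_, ⟨hu, ?_⟩, hu0, rfl⟩
      have key : ∀ r s : ℝ, 0 < r → 0 < s → Eqv P (r • a + s • b) (a + b) := fun r s hr hs =>
        Eqv.add hP (hP.smul _ hr.le _ ha) ha (hP.smul _ hs.le _ hb) hb
          (hP.eqv_smul ha hr) (hP.eqv_smul hb hs)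
      exact (key r' s' hr' hs').trans hP (key r s hr hs).symm
  · rintro ⟨u, ⟨hu, huv⟩, hu0, rfl⟩
    by_cases heq : (Projectivization.mk ℝ u hu0 : PSpace d) = Projectivization.mk ℝ v hv0
    · rw [heq]; exact mem_insert _ _
    obtain ⟨M, hM, h1, h2⟩ := huv.exists_large hP hu hv
    have ha0 : M • u - v ≠ 0 := by
      intro h
      apply heq
      rw [eq_comm, Projectivization.mk_eq_mk_iff']
      exact ⟨M, sub_eq_zero.1 h⟩
    have hb0 : M • v - u ≠ 0 := by
      intro h
      apply heq
      rw [Projectivization.mk_eq_mk_iff']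
      exact ⟨M, sub_eq_zero.1 h⟩
    have hM2 : 0 < M ^ 2 - 1 := by nlinarith
    have hcl' : ∀ w ∈ P, ∀ h : w ≠ 0, Projectivization.mk ℝ w h ∈ closure C := by
      intro w hw h
      rw [hcl]; exact mem_pr hw h
    refine Or.inr ⟨hcl' u hu hu0, _, hcl' _ h1 ha0, _, hcl' _ h2 hb0, ⟨hcl' v hv hv0, ?_⟩,
      ⟨hcl' u hu hu0, ?_⟩⟩
    · unfold cmap
      rw [chart_seg _ _ _ _ (hsgn _ ⟨hv, hv0⟩ _ ⟨h1, ha0⟩) (hsgn _ ⟨hv, hv0⟩ _ ⟨h2, hb0⟩)]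
      refine ⟨1 / (M ^ 2 - 1), M / (M ^ 2 - 1), by positivity, by positivity, ?_⟩
      rw [smul_sub, smul_sub, smul_smul, smul_smul]
      have : v = ((M ^ 2 - 1) / (M ^ 2 - 1)) • v := by rw [div_self hM2.ne', one_smul]
      conv_lhs => rw [this]
      module
    · unfold cmap
      rw [chart_seg _ _ _ _ (hsgn _ ⟨hu, hu0⟩ _ ⟨h1, ha0⟩) (hsgn _ ⟨hu, hu0⟩ _ ⟨h2, hb0⟩)]
      refine ⟨M / (M ^ 2 - 1), 1 / (M ^ 2 - 1), by positivity, by positivity, ?_⟩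
      rw [smul_sub, smul_sub, smul_smul, smul_smul]
      have : u = ((M ^ 2 - 1) / (M ^ 2 - 1)) • u := by rw [div_self hM2.ne', one_smul]
      conv_lhs => rw [this]
      module

/-- faces are properly convex -/
lemma face_pc {C : Set (PSpace d)} (hC : IsProperlyConvex C) {P : Set (Fin d → ℝ)} (hP : PC P)
    (hcl : closure C = pr P) {v : Fin d → ℝ} (hv : v ∈ P) (hv0 : v ≠ 0) :
    IsProperlyConvex (pr (FC P v)) := by
  have hsub : pr (FC P v) ⊆ closure C := by
    rw [hcl]; exact pr_mono (fun u hu => hu.1)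
  obtain ⟨h1, h2, h3⟩ := chartOf_spec hC
  refine ⟨chartOf C, fun x hx => h1 x (closure_minimal hsub isClosed_closure hx), ?_, ?_⟩
  · apply (hP.oc_FC hv hv0).convex_chart
    intro u hu
    have hu0 : u ≠ 0 := fun h => (hP.oc_FC hv hv0).zero (h ▸ hu)
    exact (rep_ne_iff _ u hu0).1 (h1 _ (hsub (mem_pr hu hu0)))
  · exact (h3.closure).subset ((image_mono hsub).trans (chart_closure_subset h1))

/-! ### The cone over a properly convex domain -/

lemma domain_cone {Ω : Set (PSpace d)} (hΩ : IsPCDomain Ω) {x : Fin d → ℝ} (hx0 : x ≠ 0)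
    (hx : Projectivization.mk ℝ x hx0 ∈ closure Ω) :
    ∃ P : Set (Fin d → ℝ), PC P ∧ IsClosed P ∧ x ∈ P ∧ closure Ω = pr P ∧
      ∀ u ∈ P, ∀ w ∈ P, ∀ hu : u ≠ 0, Projectivization.mk ℝ u hu ∈ Ω → ∀ huw : u + w ≠ 0,
        Projectivization.mk ℝ (u + w) huw ∈ Ω := by
  obtain ⟨hop, hne, hpc⟩ := hΩ
  obtain ⟨f, hf, hconv, hbdd, hfx⟩ : ∃ f : (Fin d → ℝ) →ₗ[ℝ] ℝ,
      (∀ x ∈ closure Ω, f x.rep ≠ 0) ∧ Convex ℝ (chartMap f '' Ω) ∧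
      Bornology.IsBounded (chartMap f '' Ω) ∧ 0 < f x := by
    obtain ⟨f, hf, hconv, hbdd⟩ := hpc
    rcases lt_or_gt_of_ne ((rep_ne_iff f x hx0).1 (hf _ hx)) with h | h
    · have him : chartMap (-f) '' Ω = - (chartMap f '' Ω) := by
        have : chartMap (-f) = fun x => - chartMap f x := funext (chartMap_neg f)
        rw [this, ← image_image (fun v => -v), image_neg_eq_neg]
      refine ⟨-f, fun y hy => ?_, ?_, ?_, ?_⟩
      · simpa using hf y hy
      · rw [him]; exact hconv.neg
      · rw [him]; exact hbdd.neg
      · simpa using h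
    · exact ⟨f, hf, hconv, hbdd, h⟩
  have hfc : Continuous f := f.continuous_of_finiteDimensional
  set K := closure (chartMap f '' Ω) with hK
  have hKc : IsCompact K := hbdd.isCompact_closure
  have hKconv : Convex ℝ K := hconv.closure
  have hK1 : ∀ w ∈ K, f w = 1 := fun w hw => (closure_chart_subset hf hw).1
  have hKcl : ∀ w ∈ K, ∀ h : w ≠ 0, Projectivization.mk ℝ w h ∈ closure Ω :=
    fun w hw => (closure_chart_subset hf hw).2
  have hclK : ∀ y ∈ closure Ω, chartMap f y ∈ K :=
    fun y hy => chart_closure_subset hf ⟨y, hy, rfl⟩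
  have hKne : K.Nonempty := ⟨_, hclK _ hx⟩
  let P : Set (Fin d → ℝ) := {v | 0 ≤ f v ∧ ∃ k ∈ K, v = f v • k}
  have hPmk : ∀ (r : ℝ) (k : Fin d → ℝ), 0 ≤ r → k ∈ K → r • k ∈ P := by
    intro r k hr hk
    have : f (r • k) = r := by rw [map_smul, hK1 k hk]; simp
    exact ⟨by rw [this]; exact hr, k, hk, by rw [this]⟩
  have hP : PC P := by
    refine ⟨?_, ?_, ?_, ?_⟩
    · obtain ⟨k, hk⟩ := hKne
      simpa using hPmk 0 k le_rfl hk
    · rintro u ⟨hu, k, hk, hku⟩ v ⟨hv, l, hl, hlv⟩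
      rcases (add_nonneg hu hv).eq_or_lt with h | h
      · have h1 : f u = 0 := by linarith
        have h2 : f v = 0 := by linarith
        rw [hku, hlv, h1, h2]
        simpa using hPmk 0 k le_rfl hk
      · have hm : (f u / (f u + f v)) • k + (f v / (f u + f v)) • l ∈ K :=
          hKconv hk hl (by positivity) (by positivity) (by field_simp)
        have := hPmk _ _ h.le hm
        convert this using 1
        rw [smul_add, smul_smul, smul_smul, mul_div_cancel₀ _ h.ne', mul_div_cancel₀ _ h.ne',
          ← hku, ← hlv]
    · rintro c hc u ⟨hu, k, hk, hku⟩
      rw [hku, smul_smul]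
      exact hPmk _ _ (by positivity) hk
    · rintro u ⟨hu, k, hk, hku⟩ ⟨hu', -⟩
      rw [map_neg] at hu'
      have h1 : f u = 0 := by linarith
      rw [hku, h1, zero_smul]
  have hPcl : IsClosed P := by
    have : CompactSpace K := isCompact_iff_compactSpace.1 hKc
    have h1 : IsClosed {p : (Fin d → ℝ) × K | 0 ≤ f p.1 ∧ p.1 = f p.1 • (p.2 : Fin d → ℝ)} := by
      apply IsClosed.inter
      · exact isClosed_le continuous_const (hfc.comp continuous_fst)
      · exact isClosed_eq continuous_fst
          ((hfc.comp continuous_fst).smul (continuous_subtype_val.comp continuous_snd))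
    have h2 := isClosedMap_fst_of_compactSpace _ h1
    convert h2 using 1
    ext v
    constructor
    · rintro ⟨h, k, hk, hv⟩
      exact ⟨(v, ⟨k, hk⟩), ⟨h, hv⟩, rfl⟩
    · rintro ⟨⟨v', k⟩, ⟨h, hv⟩, rfl⟩
      exact ⟨h, k, k.2, hv⟩
  have hmemP : ∀ v (hv0 : v ≠ 0), 0 < f v → Projectivization.mk ℝ v hv0 ∈ closure Ω → v ∈ P := by
    intro v hv0 hv h
    have := hPmk _ _ hv.le (hclK _ h)
    rwa [chartMap_mk, smul_smul, mul_inv_cancel₀ hv.ne', one_smul] at this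
  have hne0 : ∀ y ∈ closure Ω, chartMap f y ≠ 0 := by
    intro y hy h
    have := chartMap_apply f y (hf y hy)
    rw [h] at this
    simp at this
  refine ⟨P, hP, hPcl, hmemP x hx0 hfx hx, ?_, ?_⟩
  · ext y
    constructor
    · intro hy
      refine ⟨chartMap f y, ?_, hne0 y hy, mk_chartMap f y _⟩
      simpa using hPmk 1 _ zero_le_one (hclK y hy)
    · rintro ⟨v, ⟨hv, k, hk, hvk⟩, hv0, rfl⟩
      have hk0 : k ≠ 0 := by
        rintro rfl
        simp at hvk; exact hv0 hvk
      have h1 := hKcl k hk hk0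
      have h2 : f v • k ≠ 0 := by rwa [← hvk]
      have h3 := mk_smul k hk0 (f v) h2
      simp only [← hvk] at h3
      rw [h3]; exact h1
  · -- openness
    let A : Set (Fin d → ℝ) := {v | 0 < f v ∧ (f v)⁻¹ • v ∈ chartMap f '' Ω}
    have hAmk : ∀ (v : Fin d → ℝ) (hv : v ≠ 0), 0 < f v →
        (v ∈ A ↔ Projectivization.mk ℝ v hv ∈ Ω) := by
      intro v hv hfv
      constructor
      · rintro ⟨_, y, hy, hyv⟩
        have h1 := mk_chartMap f y (hne0 y (subset_closure hy))
        have h2 : (f v)⁻¹ • v ≠ 0 := smul_ne_zero (inv_ne_zero hfv.ne') hv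
        simp only [hyv] at h1
        rw [mk_smul v hv _ h2] at h1
        rwa [h1]
      · intro h
        exact ⟨hfv, _, h, chartMap_mk f v hv⟩
    have hAsmul : ∀ c : ℝ, 0 < c → ∀ v ∈ A, c • v ∈ A := by
      rintro c hc v ⟨h1, h2⟩
      refine ⟨by rw [map_smul, smul_eq_mul]; positivity, ?_⟩
      rw [map_smul, smul_eq_mul, smul_smul]
      convert h2 using 2
      field_simp
    have hAconv : Convex ℝ A := by
      rw [convex_iff_forall_pos]
      rintro u ⟨hu, hu'⟩ v ⟨hv, hv'⟩ a b ha hb hab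
      have hpos : 0 < f (a • u + b • v) := by
        simp only [map_add, map_smul, smul_eq_mul]; positivity
      refine ⟨hpos, ?_⟩
      have := hconv hu' hv' (a := a * f u / f (a • u + b • v)) (b := b * f v / f (a • u + b • v))
        (by positivity) (by positivity) (by
          rw [← add_div, div_eq_one_iff_eq hpos.ne']
          simp only [map_add, map_smul, smul_eq_mul])
      convert this using 1
      rw [smul_add, smul_smul, smul_smul, smul_smul, smul_smul]
      congr 2 <;> field_simp
    have hAop : IsOpen A := by
      have h1 : IsOpen ((fun v : {v : Fin d → ℝ // v ≠ 0} =>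
        (Projectivization.mk ℝ v.1 v.2 : PSpace d)) ⁻¹' Ω) :=
        hop.preimage isQuotientMap_mk.continuous
      have h2 : IsOpen (Subtype.val '' ((fun v : {v : Fin d → ℝ // v ≠ 0} =>
        (Projectivization.mk ℝ v.1 v.2 : PSpace d)) ⁻¹' Ω)) :=
        isOpen_ne.isOpenMap_subtype_val _ h1
      have h3 : A = {v | 0 < f v} ∩ (Subtype.val '' ((fun v : {v : Fin d → ℝ // v ≠ 0} =>
        (Projectivization.mk ℝ v.1 v.2 : PSpace d)) ⁻¹' Ω)) := by
        ext v
        constructor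
        · intro hv
          have hv0 : v ≠ 0 := by
            rintro rfl
            simpa using hv.1
          exact ⟨hv.1, ⟨v, hv0⟩, (hAmk v hv0 hv.1).1 hv, rfl⟩
        · rintro ⟨h, ⟨v, hv0⟩, hv, rfl⟩
          exact (hAmk v hv0 h).2 hv
      rw [h3]
      exact (isOpen_lt continuous_const hfc).inter h2
    have hPA : ∀ w ∈ P, w ≠ 0 → w ∈ closure A := by
      rintro w ⟨hw, k, hk, hwk⟩ hw0
      have hfw : 0 < f w := by
        refine lt_of_le_of_ne hw fun h => hw0 ?_
        rw [hwk, ← h, zero_smul]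
      rw [hwk]
      have : MapsTo (fun v => f w • v) (chartMap f '' Ω) A := by
        rintro _ ⟨y, hy, rfl⟩
        refine hAsmul _ hfw _ ⟨?_, ?_⟩
        · rw [chartMap_apply f y (hf y (subset_closure hy))]; exact one_pos
        · rw [chartMap_apply f y (hf y (subset_closure hy))]
          simpa using mem_image_of_mem _ hy
      exact map_mem_closure (continuous_const_smul (f w)) hk this
    rintro u hu w hw hu0 huΩ huw
    have hfpos : ∀ v ∈ P, v ≠ 0 → 0 < f v := by
      rintro w ⟨hw, k, hk, hwk⟩ hw0
      refine lt_of_le_of_ne hw fun h => hw0 ?_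
      rw [hwk, ← h, zero_smul]
    by_cases hw0 : w = 0
    · subst hw0
      simpa using huΩ
    have huA : u ∈ interior A := by
      rw [hAop.interior_eq]
      exact (hAmk u hu0 (hfpos u hu hu0)).2 huΩ
    have h1 := interior_subset (hAconv.combo_interior_closure_mem_interior huA (hPA w hw hw0)
      (a := 1/2) (b := 1/2) (by norm_num) (by norm_num) (by norm_num))
    have h2 := hAsmul 2 two_pos _ h1
    have h3 : (2:ℝ) • ((1/2 : ℝ) • u + (1/2 : ℝ) • w) = u + w := by module
    rw [h3] at h2
    exact (hAmk _ huw h2.1).1 h2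

/-! ### Simplices -/

lemma simplex_param {k : ℕ} {S : Set (PSpace d)} (hS : IsSimplexOfDim k S) :
    ∃ L : (Fin (k + 1) → ℝ) →ₗ[ℝ] (Fin d → ℝ), Function.Injective L ∧
      S = pr (L '' {c | ∀ i, 0 < c i}) := by
  obtain ⟨hk, g, hg⟩ := hS
  have hinj : Function.Injective (Fin.castLE hk) := Fin.castLE_injective hk
  let e := Function.ExtendByZero.linearMap ℝ (Fin.castLE hk : Fin (k + 1) → Fin d)
  have he : ∀ c i, e c (Fin.castLE hk i) = c i := by
    intro c i
    exact hinj.extend_apply c (0 : Fin d → ℝ) i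
  have he' : ∀ c (j : Fin d), k + 1 ≤ (j : ℕ) → e c j = 0 := by
    intro c j hj
    have : ¬ ∃ i, (Fin.castLE hk i : Fin d) = j := by
      rintro ⟨i, rfl⟩
      have := i.2
      simp only [Fin.val_castLE] at hj
      omega
    exact Function.extend_apply' c (0 : Fin d → ℝ) j this
  have heinj : Function.Injective e := by
    intro c c' h
    funext i
    rw [← he c i, ← he c' i, h]
  refine ⟨g.toLinearMap ∘ₗ e, ?_, ?_⟩
  · exact g.injective.comp heinj
  · rw [hg]
    ext q
    constructor
    · rintro ⟨v, ⟨hv1, hv2⟩, hv0, rfl⟩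
      have hv : e (fun i => v (Fin.castLE hk i)) = v := by
        funext j
        by_cases hj : (j : ℕ) < k + 1
        · exact he _ ⟨j, hj⟩
        · rw [he' _ j (not_lt.1 hj), hv2 j (not_lt.1 hj)]
      refine ⟨g v, ⟨fun i => v (Fin.castLE hk i), ?_, ?_⟩, by simpa using hv0, rfl⟩
      · intro i
        exact hv1 _ (by simpa using i.2)
      · simp [hv]
    · rintro ⟨_, ⟨c, hc, rfl⟩, h0, rfl⟩
      refine ⟨e c, ⟨?_, he' c⟩, ?_, rfl⟩
      · intro j hj
        have := he c ⟨j, hj⟩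
        have h2 : Fin.castLE hk ⟨j, hj⟩ = j := rfl
        rw [h2] at this
        rw [this]; exact hc _
      · intro h
        apply h0
        simp [h]

lemma pr_neg_image {n : ℕ} (L : (Fin n → ℝ) →ₗ[ℝ] (Fin d → ℝ)) (X : Set (Fin n → ℝ)) :
    pr ((-L) '' X) = pr (L '' X) := by
  have key : ∀ L : (Fin n → ℝ) →ₗ[ℝ] (Fin d → ℝ), pr ((-L) '' X) ⊆ pr (L '' X) := by
    rintro L _ ⟨_, ⟨c, hc, rfl⟩, h0, rfl⟩
    have h1 : L c ≠ 0 := by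
      intro h
      apply h0
      simp [h]
    refine ⟨L c, ⟨c, hc, rfl⟩, h1, ?_⟩
    rw [Projectivization.mk_eq_mk_iff']
    exact ⟨-1, by simp⟩
  apply (key L).antisymm
  have := key (-L)
  rwa [neg_neg] at this

/-- closed orthant cone -/
def SC {n : ℕ} (L : (Fin n → ℝ) →ₗ[ℝ] (Fin d → ℝ)) : Set (Fin d → ℝ) := L '' {c | ∀ i, 0 ≤ c i}

lemma mem_SC {n : ℕ} {L : (Fin n → ℝ) →ₗ[ℝ] (Fin d → ℝ)} (hL : Function.Injective L)
    (c : Fin n → ℝ) : L c ∈ SC L ↔ ∀ i, 0 ≤ c i := by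
  constructor
  · rintro ⟨c', hc', h⟩
    rw [← hL h]; exact hc'
  · intro h; exact ⟨c, h, rfl⟩

lemma pc_SC {n : ℕ} {L : (Fin n → ℝ) →ₗ[ℝ] (Fin d → ℝ)} (hL : Function.Injective L) :
    PC (SC L) := by
  refine ⟨⟨0, by simp, by simp⟩, ?_, ?_, ?_⟩
  · rintro _ ⟨c, hc, rfl⟩ _ ⟨c', hc', rfl⟩
    exact ⟨c + c', fun i => add_nonneg (hc i) (hc' i), by simp⟩
  · rintro r hr _ ⟨c, hc, rfl⟩
    exact ⟨r • c, fun i => mul_nonneg hr (hc i), by simp⟩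
  · rintro _ ⟨c, hc, rfl⟩ h
    rw [← map_neg, mem_SC hL] at h
    have : c = 0 := by
      funext i
      have h1 := h i
      have h2 := hc i
      simp only [Pi.neg_apply] at h1
      simp only [Pi.zero_apply]
      linarith
    simp [this]

lemma closure_simplex {n : ℕ} {L : (Fin n → ℝ) →ₗ[ℝ] (Fin d → ℝ)} (hL : Function.Injective L) :
    closure (pr (L '' {c | ∀ i, 0 < c i})) = pr (SC L) := by
  apply subset_antisymm
  · apply closure_minimal
    · apply pr_mono
      apply image_mono
      intro c hc i
      exact (hc i).le
    · rw [← isQuotientMap_mk.isClosed_preimage]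
      have hcl : IsClosed (SC L) := by
        have h1 := LinearMap.isClosedEmbedding_of_injective (f := L) (LinearMap.ker_eq_bot.2 hL)
        apply h1.isClosedMap
        simp only [ofPred_forall]
        exact isClosed_iInter fun i => isClosed_le continuous_const (continuous_apply i)
      have : ((fun v : {v : Fin d → ℝ // v ≠ 0} =>
        (Projectivization.mk ℝ v.1 v.2 : PSpace d)) ⁻¹' (pr (SC L))) =
          {v | v.1 ∈ SC L} ∪ {v | -v.1 ∈ SC L} := by
        ext ⟨v, hv⟩
        constructor
        · rintro ⟨w, hw, hw0, h⟩
          obtain ⟨a, ha⟩ := (Projectivization.mk_eq_mk_iff' ℝ _ _ _ _).1 h.symm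
          simp only at ha
          rcases le_total 0 a with h | h
          · left
            show v ∈ SC L
            rw [← ha]
            exact (pc_SC hL).smul a h w hw
          · right
            show -v ∈ SC L
            rw [← ha, ← neg_smul]
            exact (pc_SC hL).smul (-a) (by linarith) w hw
        · rintro (h | h)
          · exact ⟨v, h, hv, rfl⟩
          · refine ⟨-v, h, neg_ne_zero.2 hv, ?_⟩
            simp only
            rw [Projectivization.mk_eq_mk_iff']
            exact ⟨-1, by simp⟩
      rw [this]
      exact (hcl.preimage continuous_subtype_val).union
        (hcl.preimage continuous_subtype_val.neg)
  · rintro _ ⟨_, ⟨c, hc, rfl⟩, h0, rfl⟩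
    have hn : ∃ i, c i ≠ 0 := by
      by_contra h
      push Not at h
      apply h0
      have : c = 0 := funext h
      simp [this]
    obtain ⟨i0, hi0⟩ := hn
    let u : ℕ → Fin n → ℝ := fun m => c + (1 / ((m : ℝ) + 1)) • (1 : Fin n → ℝ)
    have hu : ∀ m i, 0 < u m i := by
      intro m i
      have h1 : 0 < 1 / ((m : ℝ) + 1) := by positivity
      have h2 := hc i
      simp only [u, Pi.add_apply, Pi.smul_apply, Pi.one_apply, smul_eq_mul, mul_one]
      linarith
    have hu0 : ∀ m, L (u m) ≠ 0 := by
      intro m h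
      rw [map_eq_zero_iff L hL] at h
      have := hu m i0
      rw [h] at this
      simp at this
    have hlim : Tendsto u atTop (nhds c) := by
      have h1 := (tendsto_one_div_add_atTop_nhds_zero_nat (𝕜 := ℝ)).smul_const (1 : Fin n → ℝ)
      have h2 := h1.const_add c
      rw [zero_smul, add_zero] at h2
      exact h2
    have hlim2 : Tendsto (fun m => L (u m)) atTop (nhds (L c)) :=
      (L.continuous_of_finiteDimensional.tendsto c).comp hlim
    refine mem_closure_of_tendsto (tendsto_mk hu0 h0 hlim2) (Eventually.of_forall fun m => ?_)
    exact ⟨_, ⟨u m, hu m, rfl⟩, hu0 m, rfl⟩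

lemma FC_SC_sub {n : ℕ} {L : (Fin n → ℝ) →ₗ[ℝ] (Fin d → ℝ)} (hL : Function.Injective L)
    (c : Fin n → ℝ) :
    FC (SC L) (L c) ⊆ (Submodule.span ℝ
      (range fun i : {i // c i ≠ 0} => L (Pi.single i.1 1)) : Set (Fin d → ℝ)) := by
  rintro _ ⟨⟨c', hc', rfl⟩, M, hM, h1, h2⟩
  rw [← map_smul, ← map_sub, mem_SC hL] at h1 h2
  have h3 : ∀ i, c i = 0 → c' i = 0 := by
    intro i hi
    have := h2 i
    simp only [Pi.sub_apply, Pi.smul_apply, hi, smul_zero, zero_sub] at this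
    have h4 := hc' i
    linarith
  rw [L.pi_apply_eq_sum_univ c', SetLike.mem_coe]
  refine Submodule.sum_mem _ fun i _ => ?_
  by_cases hi : c i = 0
  · rw [h3 i hi, zero_smul]; exact Submodule.zero_mem _
  · refine Submodule.smul_mem _ _ (Submodule.subset_span ⟨⟨i, hi⟩, ?_⟩)
    simp only
    congr 1
    funext j
    simp [Pi.single_apply, eq_comm]

lemma FC_SC_mem {n : ℕ} {L : (Fin n → ℝ) →ₗ[ℝ] (Fin d → ℝ)} (hL : Function.Injective L)
    {c : Fin n → ℝ} (hc : ∀ i, 0 ≤ c i) {i : Fin n} (hi : c i ≠ 0) {ε : ℝ} (hε : 0 < ε) :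
    L (Pi.single i 1) + ε • L c ∈ FC (SC L) (L c) := by
  have hP := pc_SC hL
  have hw : L (Pi.single i 1) ∈ SC L := by
    rw [mem_SC hL]
    intro j
    rw [Pi.single_apply]
    split_ifs <;> norm_num
  have hci : 0 < c i := lt_of_le_of_ne (hc i) hi.symm
  have hv : L c ∈ SC L := (mem_SC hL c).2 hc
  have hmem : L (Pi.single i 1) + ε • L c ∈ SC L := hP.add _ hw _ (hP.smul ε hε.le _ hv)
  refine ⟨hmem, hP.eqv_of (M := ε⁻¹) (N := (c i)⁻¹ + ε) hmem hv ?_ ?_⟩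
  · convert hP.smul ε⁻¹ (by positivity) _ hw using 1
    rw [smul_add, smul_smul, inv_mul_cancel₀ hε.ne', one_smul]
    abel
  · have h1 : (c i)⁻¹ • L c - L (Pi.single i 1) ∈ SC L := by
      rw [← map_smul, ← map_sub, mem_SC hL]
      intro j
      simp only [Pi.sub_apply, Pi.smul_apply, smul_eq_mul, Pi.single_apply]
      split_ifs with h
      · rw [h, inv_mul_cancel₀ hci.ne']; simp
      · have := hc j
        simp only [sub_zero]
        positivity
    convert h1 using 1
    module

/-! ### Hilbert metric -/

lemma FC_extend {P : Set (Fin d → ℝ)} (hP : PC P) {x u v : Fin d → ℝ}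
    (hu : u ∈ FC P x) (hv : v ∈ FC P x) : ∃ η : ℝ, 0 < η ∧ u + η • (u - v) ∈ FC P x := by
  obtain ⟨M, hM, h1, h2⟩ := (hu.2.trans hP hv.2.symm)
  have hM0 : M ≠ 0 := hM.ne'
  have e1 : u + M⁻¹ • (u - v) = M⁻¹ • (M • u - v) + M⁻¹ • u := by
    rw [smul_sub, smul_sub, smul_smul, inv_mul_cancel₀ hM0, one_smul]
    abel
  have hmem : u + M⁻¹ • (u - v) ∈ P := by
    rw [e1]
    exact hP.add _ (hP.smul _ (by positivity) _ h1) _ (hP.smul _ (by positivity) _ hu.1)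
  refine ⟨M⁻¹, by positivity, hmem, ?_⟩
  refine Eqv.trans hP ?_ hu.2
  refine hP.eqv_of (M := M) (N := 1 + M⁻¹) hmem hu.1 ?_ ?_
  · rw [e1, smul_add, smul_smul, smul_smul, mul_inv_cancel₀ hM0, one_smul, one_smul,
      add_sub_cancel_right]
    exact h1
  · convert hP.smul M⁻¹ (by positivity) _ hv.1 using 1
    module

lemma hilbert_bound {P : Set (Fin d → ℝ)} (hP : PC P) {x : Fin d → ℝ} (hx : x ∈ P) (hx0 : x ≠ 0)
    {f : (Fin d → ℝ) →ₗ[ℝ] ℝ} (hf : ∀ u ∈ FC P x, 0 < f u)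
    (hb : Bornology.IsBounded (chartMap f '' pr (FC P x))) {u v : Fin d → ℝ}
    (hu : u ∈ chartMap f '' pr (FC P x)) (hv : v ∈ chartMap f '' pr (FC P x)) {R : ℝ}
    (hR : 0 < R) (h : hilbertDistChart (chartMap f '' pr (FC P x)) u v < R) :
    Real.exp (2 * R) • u - v ∈ P ∧ Real.exp (2 * R) • v - u ∈ P := by
  have hE : 1 < Real.exp (2 * R) := Real.one_lt_exp_iff.2 (by linarith)
  set E := Real.exp (2 * R) with hEdef
  have hQ := hP.oc_FC hx hx0
  have hu' := (mem_chart_iff hQ hf u).1 hu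
  have hv' := (mem_chart_iff hQ hf v).1 hv
  by_cases huv : u = v
  · subst huv
    have : E • u - u ∈ P := by
      convert hP.smul (E - 1) (by linarith) _ hu'.2.1 using 1
      module
    exact ⟨this, this⟩
  unfold hilbertDistChart at h
  rw [if_neg huv] at h
  set T := {t : ℝ | u + t • (v - u) ∈ chartMap f '' pr (FC P x)} with hT
  have hTmem : ∀ t, t ∈ T ↔ u + t • (v - u) ∈ FC P x := by
    intro t
    rw [hT, mem_ofPred_eq, mem_chart_iff hQ hf]
    have : f (u + t • (v - u)) = 1 := by
      simp [hu'.1, hv'.1]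
    simp [this]
  have hTb : Bornology.IsBounded T := by
    obtain ⟨C, hC⟩ := hb.exists_norm_le
    have hpos : 0 < ‖v - u‖ := norm_pos_iff.2 (sub_ne_zero.2 (Ne.symm huv))
    refine (isBounded_iff_forall_norm_le).2 ⟨(C + ‖u‖) / ‖v - u‖, fun t ht => ?_⟩
    rw [le_div_iff₀ hpos, ← norm_smul]
    have h1 := hC _ ht
    have h2 : t • (v - u) = (u + t • (v - u)) - u := by abel
    rw [h2]
    exact (norm_sub_le _ _).trans (by linarith)
  have hba := hTb.bddAbove
  have hbb := hTb.bddBelow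
  have hneT : T.Nonempty := ⟨0, (hTmem 0).2 (by simpa using hu'.2)⟩
  have hsup : 1 < sSup T := by
    obtain ⟨η, hη, h1⟩ := FC_extend hP hv'.2 hu'.2
    have : 1 + η ∈ T := by
      rw [hTmem]
      convert h1 using 1
      module
    linarith [le_csSup hba this]
  have hinf : sInf T < 0 := by
    obtain ⟨η, hη, h1⟩ := FC_extend hP hu'.2 hv'.2
    have : -η ∈ T := by
      rw [hTmem]
      convert h1 using 1
      module
    linarith [csInf_le hbb this]
  set p := sSup T with hp
  set m := sInf T with hm
  have hden : 0 < (-m) * (p - 1) := mul_pos (by linarith) (by linarith)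
  have hX : 0 < (p * (1 - m)) / ((-m) * (p - 1)) :=
    div_pos (mul_pos (by linarith) (by linarith)) hden
  have hlt : (p * (1 - m)) / ((-m) * (p - 1)) < E := by
    rw [hEdef, ← Real.log_lt_iff_lt_exp hX]
    linarith
  rw [div_lt_iff₀ hden] at hlt
  have h1 : E / (E - 1) < p := by
    rw [div_lt_iff₀ (by linarith)]
    by_contra hcon
    push Not at hcon
    nlinarith
  have h2 : m < -(1 / (E - 1)) := by
    rw [lt_neg, div_lt_iff₀ (by linarith)]
    by_contra hcon
    push Not at hcon
    nlinarith
  constructor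
  · obtain ⟨t, ht, hlt'⟩ := exists_lt_of_csInf_lt hneT h2
    rw [lt_neg, div_lt_iff₀ (by linarith)] at hlt'
    have ht0 : 0 < -t := by
      by_contra hcon
      nlinarith
    have h3 := hP.smul (-t)⁻¹ (by positivity) _ ((hTmem t).1 ht).1
    refine hP.large hu'.2.1 (M := (-t)⁻¹ * (1 - t)) ?_ ?_
    · convert h3 using 1
      have : v = ((-t)⁻¹ * (-t)) • v := by rw [inv_mul_cancel₀ ht0.ne', one_smul]
      conv_lhs => rw [this]
      module
    · rw [inv_mul_le_iff₀ ht0]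
      nlinarith
  · obtain ⟨t, ht, hlt'⟩ := exists_lt_of_lt_csSup hneT h1
    rw [div_lt_iff₀ (by linarith)] at hlt'
    have ht0 : 0 < t - 1 := by
      by_contra hcon
      nlinarith
    have h3 := hP.smul (t - 1)⁻¹ (by positivity) _ ((hTmem t).1 ht).1
    refine hP.large hv'.2.1 (M := (t - 1)⁻¹ * t) ?_ ?_
    · convert h3 using 1
      have : u = ((t - 1)⁻¹ * (t - 1)) • u := by rw [inv_mul_cancel₀ ht0.ne', one_smul]
      conv_lhs => rw [this]
      module
    · rw [inv_mul_le_iff₀ ht0]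
      nlinarith

/-! ### The main argument -/

lemma limit_point {n : ℕ} {L : (Fin n → ℝ) →ₗ[ℝ] (Fin d → ℝ)} (hL : Function.Injective L)
    {P : Set (Fin d → ℝ)} (hP : PC P) (hPcl : IsClosed P) (hsub : SC L ⊆ P)
    {c : Fin n → ℝ} (hc : ∀ i, 0 ≤ c i) (h0 : L c ≠ 0)
    {f : (Fin d → ℝ) →ₗ[ℝ] ℝ} (hf : ∀ u ∈ FC P (L c), 0 < f u)
    (hfcl : ∀ y ∈ closure (pr (FC P (L c))), f y.rep ≠ 0)
    (hb : Bornology.IsBounded (chartMap f '' pr (FC P (L c))))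
    {R : ℝ} (hR : 0 < R) {B : Set (PSpace d)} (hB : B ⊆ pr (FC P (L c)))
    (hAB : ∀ p ∈ pr (FC (SC L) (L c)), ∃ q ∈ B,
      hilbertDistChart (chartMap f '' pr (FC P (L c))) (chartMap f p) (chartMap f q) < R)
    {i : Fin n} (hi : c i ≠ 0) :
    ∃ b ∈ Submodule.span ℝ (chartMap f '' B), b ∈ P ∧ Eqv P b (L (Pi.single i 1)) := by
  have hPS := pc_SC hL
  have hv : L c ∈ P := hsub ((mem_SC hL c).2 hc)
  have hFsub : FC (SC L) (L c) ⊆ FC P (L c) := by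
    rintro u ⟨hu, M, hM, h1, h2⟩
    exact ⟨hsub hu, M, hM, hsub h1, hsub h2⟩
  have hQ := hP.oc_FC hv h0
  have hw : L (Pi.single i 1) ∈ P := by
    apply hsub
    rw [mem_SC hL]
    intro j
    rw [Pi.single_apply]
    split_ifs <;> norm_num
  set w := L (Pi.single i 1) with hwdef
  have hw0 : w ≠ 0 := by
    rw [hwdef, Ne, map_eq_zero_iff L hL]
    intro h
    have := congrFun h i
    simp at this
  let u : ℕ → Fin d → ℝ := fun m => w + (1 / ((m : ℝ) + 1)) • L c
  have hu : ∀ m, u m ∈ FC (SC L) (L c) := fun m => FC_SC_mem hL hc hi (by positivity)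
  have hu0 : ∀ m, u m ≠ 0 := fun m h => hQ.zero (h ▸ hFsub (hu m))
  have hulim : Tendsto u atTop (nhds w) := by
    have h1 := (tendsto_one_div_add_atTop_nhds_zero_nat (𝕜 := ℝ)).smul_const (L c)
    have h2 := h1.const_add w
    rw [zero_smul, add_zero] at h2
    exact h2
  have hfc : Continuous f := f.continuous_of_finiteDimensional
  have hfw : f w ≠ 0 := by
    rw [← rep_ne_iff f w hw0]
    apply hfcl
    exact mem_closure_of_tendsto (tendsto_mk hu0 hw0 hulim)
      (Eventually.of_forall fun m => mem_pr (hFsub (hu m)) (hu0 m))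
  have hflim : Tendsto (fun m => f (u m)) atTop (nhds (f w)) := (hfc.tendsto w).comp hulim
  have hfw' : 0 < f w := by
    refine lt_of_le_of_ne ?_ hfw.symm
    exact ge_of_tendsto' hflim fun m => (hf _ (hFsub (hu m))).le
  choose q hqB hq using fun m => hAB _ (mem_pr (hu m) (hu0 m))
  have hqm : ∀ m, chartMap f (q m) ∈ chartMap f '' pr (FC P (L c)) := fun m => ⟨_, hB (hqB m), rfl⟩
  have ham : ∀ m, chartMap f (Projectivization.mk ℝ (u m) (hu0 m)) ∈
      chartMap f '' pr (FC P (L c)) := fun m => ⟨_, mem_pr (hFsub (hu m)) (hu0 m), rfl⟩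
  have key := fun m => hilbert_bound hP hv h0 hf hb (ham m) (hqm m) hR (hq m)
  simp only [chartMap_mk] at key
  obtain ⟨b, -, φ, hφ, hlim⟩ := tendsto_subseq_of_bounded hb hqm
  have halim : Tendsto (fun m => (f (u m))⁻¹ • u m) atTop (nhds ((f w)⁻¹ • w)) :=
    (hflim.inv₀ hfw).smul hulim
  have halim' := halim.comp hφ.tendsto_atTop
  have hbP : b ∈ P := hPcl.mem_of_tendsto hlim (Eventually.of_forall fun m =>
    ((mem_chart_iff hQ hf _).1 (hqm (φ m))).2.1)
  have h1 : Real.exp (2 * R) • ((f w)⁻¹ • w) - b ∈ P :=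
    hPcl.mem_of_tendsto ((halim'.const_smul _).sub hlim)
      (Eventually.of_forall fun m => (key (φ m)).1)
  have h2 : Real.exp (2 * R) • b - ((f w)⁻¹ • w) ∈ P :=
    hPcl.mem_of_tendsto ((hlim.const_smul _).sub halim')
      (Eventually.of_forall fun m => (key (φ m)).2)
  refine ⟨b, ?_, hbP, ?_⟩
  · have hcl : IsClosed (Submodule.span ℝ (chartMap f '' B) : Set (Fin d → ℝ)) :=
      Submodule.closed_of_finiteDimensional _
    exact hcl.mem_of_tendsto hlim (Eventually.of_forall fun m =>
      Submodule.subset_span ⟨_, hqB _, rfl⟩)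
  · exact (show Eqv P b ((f w)⁻¹ • w) from ⟨_, Real.exp_pos _, h2, h1⟩).trans hP
      (hP.eqv_smul hw (by positivity))

/-- disjoint faces of the simplex lie in different faces of the domain -/
lemma no_eqv {n : ℕ} {L : (Fin n → ℝ) →ₗ[ℝ] (Fin d → ℝ)} (hL : Function.Injective L)
    {Ω S : Set (PSpace d)} (hSΩ : S ⊆ Ω) (hcl : closure S ∩ Ω ⊆ S)
    (hS : S = pr (L '' {c | ∀ i, 0 < c i}))
    {P : Set (Fin d → ℝ)} (hP : PC P) (hsub : SC L ⊆ P)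
    (hopen : ∀ u ∈ P, ∀ w ∈ P, ∀ hu : u ≠ 0, Projectivization.mk ℝ u hu ∈ Ω →
      ∀ huw : u + w ≠ 0, Projectivization.mk ℝ (u + w) huw ∈ Ω)
    (a : Fin n → ℝ) (h : Eqv P (L fun i => max (a i) 0) (L fun i => max (-a i) 0)) :
    ∀ i, a i ≤ 0 := by
  intro i0
  by_contra hi0
  push Not at hi0
  let z : Fin n → ℝ := fun i => if a i ≤ 0 then 1 else 0
  have hz : ∀ i, 0 ≤ z i := by
    intro i
    simp only [z]
    split_ifs <;> norm_num
  have mem : ∀ c : Fin n → ℝ, (∀ i, 0 ≤ c i) → L c ∈ P := fun c hc => hsub ((mem_SC hL c).2 hc)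
  let p : Fin n → ℝ := (fun i => max (a i) 0) + z
  let q : Fin n → ℝ := (fun i => max (-a i) 0) + z
  have hp : ∀ i, 0 < p i := by
    intro i
    simp only [p, z, Pi.add_apply]
    split_ifs with h
    · have := le_max_right (a i) 0
      linarith
    · have := le_max_left (a i) 0
      push Not at h
      linarith
  have hq : ∀ i, 0 ≤ q i := fun i => add_nonneg (le_max_right _ _) (hz i)
  have hq0 : q i0 = 0 := by
    simp only [q, z, Pi.add_apply]
    rw [if_neg (not_le.2 hi0), max_eq_right (by linarith)]
    simp
  have hpP : L p ∈ P := mem p fun i => (hp i).le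
  have hp0 : L p ≠ 0 := by
    rw [Ne, map_eq_zero_iff L hL]
    intro h
    have := hp i0
    rw [h] at this
    simp at this
  have hpq : Eqv P (L p) (L q) := by
    simp only [p, q, map_add]
    exact Eqv.add hP (mem _ fun i => le_max_right _ _) (mem _ fun i => le_max_right _ _)
      (mem _ hz) (mem _ hz) h (hP.eqv_refl _)
  have hqne : L q ≠ 0 := hpq.symm.ne_zero hP hpP hp0
  have hpΩ : Projectivization.mk ℝ (L p) hp0 ∈ Ω := by
    apply hSΩ
    rw [hS]
    exact ⟨_, ⟨p, hp, rfl⟩, hp0, rfl⟩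
  obtain ⟨M, hM, h1, h2⟩ := hpq
  have hMq : M • L q ≠ 0 := smul_ne_zero hM.ne' hqne
  have he : L p + (M • L q - L p) = M • L q := by abel
  have h3 := hopen _ hpP _ h2 hp0 hpΩ (by rw [he]; exact hMq)
  simp only [he] at h3
  rw [mk_smul _ hqne] at h3
  have h4 : Projectivization.mk ℝ (L q) hqne ∈ S := by
    apply hcl
    refine ⟨?_, h3⟩
    rw [hS, closure_simplex hL]
    exact mem_pr ((mem_SC hL q).2 hq) hqne
  rw [hS] at h4
  obtain ⟨_, ⟨r, hr, rfl⟩, hr0, h5⟩ := h4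
  obtain ⟨t, ht⟩ := (Projectivization.mk_eq_mk_iff' ℝ _ _ _ _).1 h5
  rw [← map_smul] at ht
  have h6 := congrFun (hL ht) i0
  have h7 := hr i0
  simp only [Pi.smul_apply, hq0, smul_zero] at h6
  linarith

lemma linInd_of {n : ℕ} {L : (Fin n → ℝ) →ₗ[ℝ] (Fin d → ℝ)} (hL : Function.Injective L)
    {Ω S : Set (PSpace d)} (hSΩ : S ⊆ Ω) (hcl : closure S ∩ Ω ⊆ S)
    (hS : S = pr (L '' {c | ∀ i, 0 < c i}))
    {P : Set (Fin d → ℝ)} (hP : PC P) (hsub : SC L ⊆ P)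
    (hopen : ∀ u ∈ P, ∀ w ∈ P, ∀ hu : u ≠ 0, Projectivization.mk ℝ u hu ∈ Ω →
      ∀ huw : u + w ≠ 0, Projectivization.mk ℝ (u + w) huw ∈ Ω)
    {p : Fin n → Prop} (b : {i // p i} → Fin d → ℝ) (hb : ∀ i, b i ∈ P)
    (hbe : ∀ i, Eqv P (b i) (L (Pi.single i.1 1))) : LinearIndependent ℝ b := by
  classical
  rw [Fintype.linearIndependent_iff]
  intro g hg
  let a : Fin n → ℝ := fun i => if h : p i then g ⟨i, h⟩ else 0
  have ha : ∀ i : {i // p i}, a i = g i := by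
    rintro ⟨i, hi⟩
    simp [a, hi]
  have hwP : ∀ i : Fin n, L (Pi.single i 1) ∈ P := by
    intro i
    apply hsub
    rw [mem_SC hL]
    intro j
    rw [Pi.single_apply]
    split_ifs <;> norm_num
  have key : ∀ g : {i // p i} → ℝ, ∀ a : Fin n → ℝ, (∀ i : {i // p i}, a i = g i) →
      (∀ i, ¬ p i → a i = 0) →
      Eqv P (∑ i, max (g i) 0 • b i) (L fun i => max (a i) 0) := by
    intro g a ha ha'
    have h1 := (hP.eqv_sum Finset.univ (u := fun i => max (g i) 0 • b i)
      (v := fun i : {i // p i} => max (g i) 0 • L (Pi.single i.1 1))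
      (fun i => hP.smul _ (le_max_right _ _) _ (hb i))
      (fun i => hP.smul _ (le_max_right _ _) _ (hwP i))
      (fun i => (hbe i).smul hP (le_max_right _ _))).2.2
    convert h1 using 1
    have hs : ∀ i : Fin n, (fun j => if i = j then (1 : ℝ) else 0) = Pi.single i 1 := by
      intro i
      funext j
      simp [Pi.single_apply, eq_comm]
    rw [L.pi_apply_eq_sum_univ]
    simp only [hs]
    rw [← Fintype.sum_subtype_add_sum_subtype p (fun i => max (a i) 0 • L (Pi.single i 1))]
    rw [Finset.sum_eq_zero (s := (Finset.univ : Finset {i // ¬ p i})), add_zero]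
    · exact Finset.sum_congr rfl fun i _ => by rw [ha i]
    · rintro ⟨i, hi⟩ -
      simp [ha' i hi]
  have hneg : ∑ i, max (g i) 0 • b i = ∑ i, max (-g i) 0 • b i := by
    rw [← sub_eq_zero, ← Finset.sum_sub_distrib, ← hg]
    refine Finset.sum_congr rfl fun i _ => ?_
    rw [← sub_smul]
    congr 1
    rcases le_total (g i) 0 with h | h
    · rw [max_eq_right h, max_eq_left (by linarith)]; ring
    · rw [max_eq_left h, max_eq_right (by linarith)]; ring
  have ha0 : ∀ i, ¬ p i → a i = 0 := fun i hi => by simp [a, hi]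
  have k1 := key g a ha ha0
  have k2 := key (fun i => -g i) (fun i => -a i) (fun i => by rw [ha]) (fun i hi => by simp [ha0 i hi])
  rw [hneg] at k1
  have k3 := k1.symm.trans hP k2
  have r1 := no_eqv hL hSΩ hcl hS hP hsub hopen a k3
  have r2 := no_eqv hL hSΩ hcl hS hP hsub hopen (fun i => -a i) (by
    simp only [neg_neg]; exact k3.symm)
  intro i
  have s1 := r1 i
  have s2 := r2 i
  simp only [ha] at s1 s2
  linarith

lemma main_aux {n : ℕ} (hn : 0 < n) {L : (Fin n → ℝ) →ₗ[ℝ] (Fin d → ℝ)}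
    (hL : Function.Injective L)
    {Ω S : Set (PSpace d)} (hΩ : IsPCDomain Ω) (hSΩ : S ⊆ Ω) (hcl : closure S ∩ Ω ⊆ S)
    (hS : S = pr (L '' {c | ∀ i, 0 < c i}))
    {c : Fin n → ℝ} (hc : ∀ i, 0 ≤ c i) (h0 : L c ≠ 0)
    (hpos : ¬ chartOf (face Ω (Projectivization.mk ℝ (L c) h0)) (L c) < 0) :
    cdim (face Ω (Projectivization.mk ℝ (L c) h0)) (face S (Projectivization.mk ℝ (L c) h0)) =
      pdim (face S (Projectivization.mk ℝ (L c) h0)) := by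
  have hPS := pc_SC hL
  have hclS : closure S = pr (SC L) := by rw [hS, closure_simplex hL]
  have hvS : L c ∈ SC L := (mem_SC hL c).2 hc
  have hclsub : closure S ⊆ closure Ω := closure_mono hSΩ
  have hxΩ : Projectivization.mk ℝ (L c) h0 ∈ closure Ω := by
    apply hclsub
    rw [hclS]; exact mem_pr hvS h0
  obtain ⟨P, hP, hPcl, hv, hclΩ, hopen⟩ := domain_cone hΩ h0 hxΩ
  obtain ⟨hΩ1, hΩ2, hΩ3⟩ := chartOf_spec hΩ.2.2
  have hfP : ∀ u ∈ {u | u ∈ P ∧ u ≠ 0}, chartOf Ω u ≠ 0 := by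
    rintro u ⟨hu, hu0⟩
    refine (rep_ne_iff _ u hu0).1 (hΩ1 _ ?_)
    rw [hclΩ]; exact mem_pr hu hu0
  have hsub : SC L ⊆ P := by
    have h1 : {u | u ∈ SC L ∧ u ≠ 0} ⊆ {u | u ∈ P ∧ u ≠ 0} := by
      refine hPS.oc.mem_of hP.oc hfP ?_ ⟨hvS, h0⟩ ⟨hv, h0⟩
      rintro _ ⟨u, ⟨hu, _⟩, hu0, rfl⟩
      have h2 : Projectivization.mk ℝ u hu0 ∈ pr P := by
        rw [← hclΩ]
        apply hclsub
        rw [hclS]; exact mem_pr hu hu0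
      obtain ⟨u', hu', hu0', h3⟩ := h2
      exact ⟨u', ⟨hu', hu0'⟩, hu0', h3⟩
    intro u hu
    by_cases hu0 : u = 0
    · rw [hu0]; exact hP.zero
    · exact (h1 ⟨hu, hu0⟩).1
  have hSpc : IsProperlyConvex S := by
    refine ⟨chartOf Ω, fun y hy => hΩ1 y (hclsub hy), ?_, hΩ3.subset (image_mono hSΩ)⟩
    have hoc : OC (L '' {c | ∀ i, 0 < c i}) := by
      refine ⟨?_, ?_, ?_⟩
      · rintro ⟨r, hr, h⟩
        rw [map_eq_zero_iff L hL] at h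
        have := hr ⟨0, hn⟩
        rw [h] at this
        simp at this
      · rintro _ ⟨r, hr, rfl⟩ _ ⟨s, hs, rfl⟩
        exact ⟨r + s, fun i => add_pos (hr i) (hs i), by simp⟩
      · rintro t ht _ ⟨r, hr, rfl⟩
        exact ⟨t • r, fun i => mul_pos ht (hr i), by simp⟩
    rw [hS]
    apply hoc.convex_chart
    intro u hu
    have hu0 : u ≠ 0 := fun h => hoc.zero (h ▸ hu)
    refine (rep_ne_iff _ u hu0).1 (hΩ1 _ (subset_closure (hSΩ ?_)))
    rw [hS]; exact mem_pr hu hu0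
  have hFpc := face_pc hΩ.2.2 hP hclΩ hv h0
  have hGpc := face_pc hSpc hPS hclS hvS h0
  rw [face_eq hΩ.2.2 hP hclΩ hv h0] at hpos ⊢
  rw [face_eq hSpc hPS hclS hvS h0]
  obtain ⟨hF1, hF2, hF3⟩ := chartOf_spec hFpc
  obtain ⟨hG1, hG2, hG3⟩ := chartOf_spec hGpc
  have hQ := hP.oc_FC hv h0
  have hQS := hPS.oc_FC hvS h0
  have hvF : L c ∈ FC P (L c) := ⟨hv, hP.eqv_refl _⟩
  have hvG : L c ∈ FC (SC L) (L c) := ⟨hvS, hPS.eqv_refl _⟩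
  have hFsub : FC (SC L) (L c) ⊆ FC P (L c) := by
    rintro u ⟨hu, M, hM, h1, h2⟩
    exact ⟨hsub hu, M, hM, hsub h1, hsub h2⟩
  have hne : ∀ u ∈ FC P (L c), chartOf (pr (FC P (L c))) u ≠ 0 := by
    intro u hu
    have hu0 : u ≠ 0 := fun h => hQ.zero (h ▸ hu)
    exact (rep_ne_iff _ u hu0).1 (hF1 _ (subset_closure (mem_pr hu hu0)))
  have hneS : ∀ u ∈ FC (SC L) (L c), chartOf (pr (FC (SC L) (L c))) u ≠ 0 := by
    intro u hu
    have hu0 : u ≠ 0 := fun h => hQS.zero (h ▸ hu)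
    exact (rep_ne_iff _ u hu0).1 (hG1 _ (subset_closure (mem_pr hu hu0)))
  have hfv : 0 < chartOf (pr (FC P (L c))) (L c) :=
    lt_of_le_of_ne (not_lt.1 hpos) (hne _ hvF).symm
  have hf : ∀ u ∈ FC P (L c), 0 < chartOf (pr (FC P (L c))) u := fun u hu =>
    pos_of_mul_pos_left (hQ.sgn hne u hu _ hvF) hfv.le
  have hdim : pdim (pr (FC (SC L) (L c))) + 1 =
      Module.finrank ℝ (Submodule.span ℝ (FC (SC L) (L c))) :=
    finrank_chart_pr hQS ⟨_, hvG⟩ hneS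
  have hdim' : pdimIn (pr (FC P (L c))) (pr (FC (SC L) (L c))) + 1 =
      Module.finrank ℝ (Submodule.span ℝ (FC (SC L) (L c))) :=
    finrank_chart_pr hQS ⟨_, hvG⟩ (fun u hu => hne u (hFsub hu))
  have hmem : pdim (pr (FC (SC L) (L c))) ∈ {k : ℕ | ∃ R : ℝ, 0 < R ∧ ∃ B : Set (PSpace d),
      B ⊆ pr (FC P (L c)) ∧
      Convex ℝ (cmap (pr (FC P (L c))) '' B) ∧ pdimIn (pr (FC P (L c))) B = k ∧
      pr (FC (SC L) (L c)) ⊆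
        {p ∈ pr (FC P (L c)) | ∃ q ∈ B, hilbertDist (pr (FC P (L c))) p q < R}} := by
    refine ⟨1, one_pos, pr (FC (SC L) (L c)), pr_mono hFsub, ?_, by omega, ?_⟩
    · exact hQS.convex_chart (fun u hu => hne u (hFsub hu))
    · intro p hp
      refine ⟨pr_mono hFsub hp, p, hp, ?_⟩
      simp [hilbertDist, hilbertDistChart]
  unfold cdim
  apply le_antisymm
  · exact Nat.sInf_le hmem
  · refine le_csInf ⟨_, hmem⟩ ?_
    rintro j ⟨R, hR, B, hB, -, hBj, hAB⟩
    have hlp : ∀ i : {i // c i ≠ 0}, ∃ b ∈ Submodule.span ℝ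
        (chartMap (chartOf (pr (FC P (L c)))) '' B), b ∈ P ∧ Eqv P b (L (Pi.single i.1 1)) :=
      fun i => limit_point hL hP hPcl hsub hc h0 hf hF1 hF3 hR hB (fun p hp => (hAB hp).2) i.2
    choose b hb1 hb2 hb3 using hlp
    have hli := linInd_of hL hSΩ hcl hS hP hsub hopen b hb2 hb3
    have hBne : B.Nonempty := by
      obtain ⟨-, q, hq, -⟩ := hAB (mem_pr hvG h0)
      exact ⟨q, hq⟩
    have hBdim : pdimIn (pr (FC P (L c))) B + 1 = Module.finrank ℝ
        (Submodule.span ℝ (chartMap (chartOf (pr (FC P (L c)))) '' B)) := by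
      apply finrank_chart (hBne.image _) (chartOf (pr (FC P (L c))))
      rintro _ ⟨y, hy, rfl⟩
      exact chartMap_apply _ _ (hF1 y (subset_closure (hB hy)))
    have e1 : Module.finrank ℝ (Submodule.span ℝ (FC (SC L) (L c))) ≤
        Fintype.card {i // c i ≠ 0} :=
      (Submodule.finrank_mono (Submodule.span_le.2 (FC_SC_sub hL c))).trans
        (finrank_range_le_card _)
    have e2 : Fintype.card {i // c i ≠ 0} ≤ Module.finrank ℝ
        (Submodule.span ℝ (chartMap (chartOf (pr (FC P (L c)))) '' B)) := by
      rw [← finrank_span_eq_card hli]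
      apply Submodule.finrank_mono
      rw [Submodule.span_le]
      rintro _ ⟨i, rfl⟩
      exact hb1 i
    omega

lemma main_thm (Ω S : Set (PSpace d)) (hΩ : IsPCDomain Ω)
    (k : ℕ) (hS : IsSimplexOfDim k S) (hSpe : IsProperlyEmbedded S Ω)
    (x : PSpace d) (hx : x ∈ closure S) :
    cdim (face Ω x) (face S x) = pdim (face S x) := by
  obtain ⟨hSΩ, hprop⟩ := hSpe
  have hcl : closure S ∩ Ω ⊆ S := by
    rintro y ⟨hy, hyΩ⟩
    have h1 : IsClosed (range (Set.inclusion hSΩ)) := hprop.isClosedMap.isClosed_range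
    rw [Set.range_inclusion] at h1
    obtain ⟨t, ht, ht'⟩ := isClosed_induced_iff.1 h1
    have h2 : S ⊆ t := by
      intro z hz
      have : (⟨z, hSΩ hz⟩ : Ω) ∈ Subtype.val ⁻¹' t := by rw [ht']; exact hz
      exact this
    have h3 : (⟨y, hyΩ⟩ : Ω) ∈ Subtype.val ⁻¹' t := closure_minimal h2 ht hy
    rw [ht'] at h3
    exact h3
  obtain ⟨L, hL, hSL⟩ := simplex_param hS
  have hx' := hx
  rw [hSL, closure_simplex hL] at hx'
  obtain ⟨_, ⟨c, hc, rfl⟩, h0, rfl⟩ := hx'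
  by_cases hpos : chartOf (face Ω (Projectivization.mk ℝ (L c) h0)) (L c) < 0
  · have h0' : (-L) c ≠ 0 := by simpa using h0
    have hmk : (Projectivization.mk ℝ (L c) h0 : PSpace d) =
        Projectivization.mk ℝ ((-L) c) h0' := by
      rw [Projectivization.mk_eq_mk_iff']
      exact ⟨-1, by simp⟩
    rw [hmk] at hpos ⊢
    refine main_aux (Nat.succ_pos k) (L := -L) ?_ hΩ hSΩ hcl ?_ hc h0' ?_
    · intro a b hab
      apply hL
      simpa using hab
    · rw [pr_neg_image]; exact hSL
    · have hneg : ∀ F : (Fin d → ℝ) →ₗ[ℝ] ℝ, F (L c) < 0 → ¬ F ((-L) c) < 0 := by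
        intro F hF
        rw [LinearMap.neg_apply, map_neg, not_lt]
        linarith
      exact hneg _ hpos
  · exact main_aux (Nat.succ_pos k) hL hΩ hSΩ hcl hSL hc h0 hpos

/-- Observation 4.1: for a properly embedded simplex `S ⊆ Ω` and any
`x ∈ closure S`, the coarse dimension of `F_S(x)` inside `F_Ω(x)` equals `dim F_S(x)`. -/
theorem cdim_of_simplex_face {d : ℕ} (Ω S : Set (PSpace d)) (hΩ : IsPCDomain Ω)
    (k : ℕ) (hS : IsSimplexOfDim k S) (hSpe : IsProperlyEmbedded S Ω)
    (x : PSpace d) (hx : x ∈ closure S) :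
    cdim (face Ω x) (face S x) = pdim (face S x) := by
  exact main_thm Ω S hΩ k hS hSpe x hx

end Paper
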